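/- arXiv:2405.09736 — 4 statements merged into one kernel-verified Lean document; each statement's English description precedes it below -/
import Mathlib

section
/- Let m,n ∈ ℤ with 0 < m ≤ |n|. The Baumslag–Solitar group BS(m,n) is residually finite if and only if m = 1 or m = |n|. -/
/-- The Baumslag–Solitar relations for `BS(m,n)`: one relation `t⁻¹ aᵐ t a⁻ⁿ`. -/
def BSrels (m n : ℤ) : Set (FreeGroup Bool) :=
  {(FreeGroup.of true)⁻¹ * (FreeGroup.of false) ^ m * FreeGroup.of true *
    (FreeGroup.of false) ^ (-n)}

/-- The Baumslag–Solitar group `BS(m,n) = ⟨a, t ∣ t⁻¹ aᵐ t = aⁿ⟩`. -/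
def BS (m n : ℤ) : Type := PresentedGroup (BSrels m n)

instance (m n : ℤ) : Group (BS m n) :=
  inferInstanceAs (Group (PresentedGroup (BSrels m n)))

/-- The generator `a` of `BS(m,n)`. -/
def BSa (m n : ℤ) : BS m n := PresentedGroup.of false

/-- The generator `t` of `BS(m,n)`. -/
def BSt (m n : ℤ) : BS m n := PresentedGroup.of true

/-- The relations of `H(n,r,s)`: `t⁻¹ a t a⁻ⁿ`, `tʳ`, `aˢ`. -/
def Hrels (n r s : ℤ) : Set (FreeGroup Bool) :=
  {(FreeGroup.of true)⁻¹ * FreeGroup.of false * FreeGroup.of true * (FreeGroup.of false) ^ (-n),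
   (FreeGroup.of true) ^ r, (FreeGroup.of false) ^ s}

/-- The group `H(n,r,s) = ⟨a, t ∣ t⁻¹ a t = aⁿ, tʳ = 1, aˢ = 1⟩`. -/
def Hgrp (n r s : ℤ) : Type := PresentedGroup (Hrels n r s)

instance (n r s : ℤ) : Group (Hgrp n r s) :=
  inferInstanceAs (Group (PresentedGroup (Hrels n r s)))

/-- The generator `a` of `H(n,r,s)`. -/
def Ha (n r s : ℤ) : Hgrp n r s := PresentedGroup.of false

/-- The generator `t` of `H(n,r,s)`. -/
def Ht (n r s : ℤ) : Hgrp n r s := PresentedGroup.of true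

/-- A class of groups: a predicate on (Type-0) groups. -/
def GroupClass : Type 1 := ∀ (G : Type) [Group G], Prop

/-- A class of groups consists only of periodic (torsion) groups. -/
def PeriodicClass (C : GroupClass) : Prop :=
  ∀ (G : Type) [Group G], C G → ∀ g : G, IsOfFinOrder g

/-- `C` is a root class: closed under isomorphism, contains a non-trivial group, closed under
subgroups, extensions and unrestricted direct products `∏_{y ∈ Y} X` with `X, Y ∈ C`. -/
structure IsRootClass (C : GroupClass) : Prop where
  iso_closed : ∀ (G H : Type) [Group G] [Group H], (G ≃* H) → C G → C H
  has_nontrivial : ∃ (G : Type) (_ : Group G), C G ∧ Nontrivial G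
  subgroup_closed : ∀ (G : Type) [Group G] (H : Subgroup G), C G → C H
  extension_closed : ∀ (G : Type) [Group G] (N : Subgroup G) [N.Normal],
    C N → C (G ⧸ N) → C G
  pi_closed : ∀ (X Y : Type) [Group X] [Group Y], C X → C Y → C (Y → X)

/-- `𝔓(C)`: the set of primes dividing the order of some element of some group in `C`. -/
def PrimesOf (C : GroupClass) : Set ℕ :=
  {p | p.Prime ∧ ∃ (G : Type) (_ : Group G), C G ∧ ∃ g : G, p ∣ orderOf g}

/-- A natural number is a `P`-number: all its prime divisors lie in `P`. -/
def IsPNat (P : Set ℕ) (k : ℕ) : Prop := ∀ p : ℕ, p.Prime → p ∣ k → p ∈ P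

/-- An integer is a `P`-number: all its prime divisors lie in `P`. -/
def IsPInt (P : Set ℕ) (k : ℤ) : Prop := ∀ p : ℕ, p.Prime → (p : ℤ) ∣ k → p ∈ P

/-- The class `𝓕_P` of finite groups whose order is a `P`-number. -/
def FClass (P : Set ℕ) (G : Type) [Group G] : Prop :=
  Finite G ∧ IsPNat P (Nat.card G)

/-- The class `𝓕𝓢_P` of finite solvable groups whose order is a `P`-number. -/
def FSClass (P : Set ℕ) (G : Type) [Group G] : Prop :=
  Finite G ∧ IsSolvable G ∧ IsPNat P (Nat.card G)

/-- `X` is conjugacy `C`-separable. -/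
def ConjSep (C : GroupClass) (X : Type) [Group X] : Prop :=
  ∀ x y : X, ¬IsConj x y →
    ∃ (G : Type) (_ : Group G), C G ∧
      ∃ σ : X →* G, Function.Surjective σ ∧ ¬IsConj (σ x) (σ y)

/-- `X` is residually a `C`-group. -/
def ResiduallyIn (C : GroupClass) (X : Type) [Group X] : Prop :=
  ∀ x y : X, x ≠ y →
    ∃ (G : Type) (_ : Group G), C G ∧
      ∃ σ : X →* G, Function.Surjective σ ∧ σ x ≠ σ y

/-- `X` is residually finite. -/
def ResiduallyFinite (X : Type) [Group X] : Prop :=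
  ∀ x y : X, x ≠ y →
    ∃ (G : Type) (_ : Group G), Finite G ∧
      ∃ σ : X →* G, Function.Surjective σ ∧ σ x ≠ σ y

/-- `X` is conjugacy (finite) separable. -/
def ConjugacySeparable (X : Type) [Group X] : Prop :=
  ∀ x y : X, ¬IsConj x y →
    ∃ (G : Type) (_ : Group G), Finite G ∧
      ∃ σ : X →* G, Function.Surjective σ ∧ ¬IsConj (σ x) (σ y)

/-- `Ξ(n,P)`: positive `P`-numbers `s` such that `n ^ r ≡ 1 (mod s)` for some positive
`P`-number `r`. -/
def Xi (n : ℤ) (P : Set ℕ) : Set ℤ :=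
  {s | 0 < s ∧ IsPInt P s ∧ ∃ r : ℤ, 0 < r ∧ IsPInt P r ∧ n ^ r.toNat ≡ 1 [ZMOD s]}

/-- `Ω(n,P)`: pairs `(r,s)` of positive `P`-numbers with `n ^ r ≡ 1 (mod s)`. -/
def OmegaP (n : ℤ) (P : Set ℕ) : Set (ℤ × ℤ) :=
  {rs | 0 < rs.1 ∧ 0 < rs.2 ∧ IsPInt P rs.1 ∧ IsPInt P rs.2 ∧
    n ^ rs.1.toNat ≡ 1 [ZMOD rs.2]}

theorem BSt_inv_mul_BSa_zpow_mul_BSt (m n : ℤ) :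
    (BSt m n)⁻¹ * BSa m n ^ m * BSt m n = BSa m n ^ n := by
  have h : PresentedGroup.mk (BSrels m n) ((FreeGroup.of true)⁻¹ * (FreeGroup.of false) ^ m *
      FreeGroup.of true * (FreeGroup.of false) ^ (-n)) = 1 :=
    PresentedGroup.one_of_mem rfl
  simp only [map_mul, map_inv, map_zpow, zpow_neg] at h
  exact mul_inv_eq_one.mp h

theorem closure_BSa_BSt (m n : ℤ) : Subgroup.closure {BSa m n, BSt m n} = ⊤ := by
  rw [eq_top_iff]
  intro g _
  refine PresentedGroup.generated_by _ _ (fun b => ?_) g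
  cases b
  · exact Subgroup.subset_closure (Set.mem_insert _ _)
  · exact Subgroup.subset_closure (Set.mem_insert_of_mem _ rfl)

section Lift

variable {G : Type*} [Group G] {m n : ℤ} {a t : G}

/-- The homomorphism from `BS(m,n)` determined by two elements that satisfy its relation. -/
def BSlift (h : t⁻¹ * a ^ m * t = a ^ n) : BS m n →* G :=
  PresentedGroup.toGroup (f := fun b : Bool => if b then t else a) (rels := BSrels m n) (by
    rintro r rfl
    simp [h])

@[simp]
theorem BSlift_BSa (h : t⁻¹ * a ^ m * t = a ^ n) : BSlift h (BSa m n) = a :=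
  PresentedGroup.toGroup.of _

@[simp]
theorem BSlift_BSt (h : t⁻¹ * a ^ m * t = a ^ n) : BSlift h (BSt m n) = t :=
  PresentedGroup.toGroup.of _

end Lift

theorem residuallyFinite_of_forall_ne_one {X : Type} [Group X]
    (h : ∀ g : X, g ≠ 1 → ∃ (G : Type) (_ : Group G), Finite G ∧ ∃ σ : X →* G, σ g ≠ 1) :
    ResiduallyFinite X := by
  intro x y hxy
  obtain ⟨G, _, _, σ, hσ⟩ := h (x * y⁻¹) (mt mul_inv_eq_one.mp hxy)
  refine ⟨σ.range, inferInstance, inferInstance, σ.rangeRestrict, σ.rangeRestrict_surjective, ?_⟩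
  intro he
  apply hσ
  rw [map_mul, map_inv, mul_inv_eq_one]
  exact congrArg Subtype.val he

/-! ### The Baumslag–Solitar groups that are not residually finite -/

/-- In a finite group, `t⁻¹ * a ^ m * t = a ^ n` forces `t` to conjugate `a ^ gcd m n`
into the cyclic subgroup generated by `a`. -/
theorem conj_zpow_gcd_mem_zpowers {G : Type*} [Group G] [Finite G] {a t : G} {m n : ℤ}
    (h : t⁻¹ * a ^ m * t = a ^ n) :
    t * a ^ (Int.gcd m n : ℤ) * t⁻¹ ∈ Subgroup.zpowers a := by
  have h' : t * a ^ n * t⁻¹ = a ^ m := by rw [← h]; group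
  have ho : orderOf (a ^ m) = orderOf (a ^ n) := by
    rw [← h', ← MulAut.conj_apply]
    exact MulEquiv.orderOf_eq _ _
  have horder (k : ℤ) : orderOf (a ^ k) = orderOf a / Nat.gcd (orderOf a) k.natAbs := by
    rw [← orderOf_pow]
    obtain hk | hk := Int.natAbs_eq k
    · conv_lhs => rw [hk, zpow_natCast]
    · conv_lhs => rw [hk, zpow_neg, zpow_natCast, orderOf_inv]
  rw [horder, horder] at ho
  have hs := orderOf_pos a
  have hd : Nat.gcd (orderOf a) m.natAbs = Nat.gcd (orderOf a) n.natAbs := by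
    have h1 := Nat.div_mul_cancel (Nat.gcd_dvd_left (orderOf a) m.natAbs)
    have h2 := Nat.div_mul_cancel (Nat.gcd_dvd_left (orderOf a) n.natAbs)
    rw [ho] at h1
    refine Nat.eq_of_mul_eq_mul_left (Nat.pos_of_ne_zero ?_) (h1.trans h2.symm)
    intro h0
    rw [h0, zero_mul] at h2
    omega
  have hdvd : Nat.gcd (orderOf a) n.natAbs ∣ Int.gcd m n :=
    Nat.dvd_gcd (hd ▸ Nat.gcd_dvd_right _ _) (Nat.gcd_dvd_right _ _)
  obtain ⟨q, hq⟩ := hdvd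
  have hbez := Int.gcd_eq_gcd_ab (orderOf a) n
  have hg : (Int.gcd m n : ℤ) = orderOf a * (Int.gcdA (orderOf a) n * q) +
      n * (Int.gcdB (orderOf a) n * q) := by
    have : Int.gcd (orderOf a) n = Nat.gcd (orderOf a) n.natAbs := rfl
    rw [hq, ← this]
    push_cast
    rw [hbez]
    ring
  rw [hg, zpow_add, zpow_mul, zpow_natCast, pow_orderOf_eq_one, one_zpow, one_mul, zpow_mul,
    ← conj_zpow, h', ← zpow_mul]
  exact Subgroup.zpow_mem_zpowers _ _

/-- The commutator of `t * a ^ k * t⁻¹` and `a` is a reduced word of `BS(m,n)`. -/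
theorem conj_zpow_not_commute {m n k : ℤ} (hm : m ≠ 0) (hn : n ≠ 0) (hm1 : ¬ m ∣ 1)
    (hnk : ¬ n ∣ k) :
    ¬ Commute (BSt m n * BSa m n ^ k * (BSt m n)⁻¹) (BSa m n) := by
  have hinj (j : ℤ) (hj : j ≠ 0) :
      Function.Injective (zpowGroupHom j : Multiplicative ℤ →* Multiplicative ℤ) := by
    intro x y hxy
    have : j * x.toAdd = j * y.toAdd := by simpa using congrArg Multiplicative.toAdd hxy
    exact Multiplicative.toAdd.injective (mul_left_cancel₀ hj this)
  have hmem (j i : ℤ) : Multiplicative.ofAdd i ∈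
      (zpowGroupHom j : Multiplicative ℤ →* Multiplicative ℤ).range ↔ j ∣ i := by
    constructor
    · rintro ⟨x, hx⟩
      exact ⟨x.toAdd, by simpa using (congrArg Multiplicative.toAdd hx).symm⟩
    · rintro ⟨x, rfl⟩
      exact ⟨Multiplicative.ofAdd x,
        by simp only [zpowGroupHom_apply, ← ofAdd_zsmul, smul_eq_mul]⟩
  let e := (MonoidHom.ofInjective (hinj n hn)).symm.trans (MonoidHom.ofInjective (hinj m hm))
  let a := HNNExtension.of (φ := e) (Multiplicative.ofAdd 1)
  let t := HNNExtension.t (φ := e)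
  have hof (i : ℤ) : HNNExtension.of (φ := e) (Multiplicative.ofAdd i) = a ^ i := by
    simp only [a, ← map_zpow, ← ofAdd_zsmul, smul_eq_mul, mul_one]
  have hrel : t⁻¹ * a ^ m * t = a ^ n := by
    have h := HNNExtension.t_mul_of (φ := e)
      (MonoidHom.ofInjective (hinj n hn) (Multiplicative.ofAdd 1))
    have h1 : t * a ^ n = a ^ m * t := by
      simpa only [e, MulEquiv.trans_apply, MulEquiv.symm_apply_apply, MonoidHom.ofInjective_apply,
        zpowGroupHom_apply, map_zpow] using h
    rw [mul_assoc, ← h1, inv_mul_cancel_left]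
  intro hc
  have hc' := hc.map (BSlift hrel)
  simp only [map_mul, map_inv, map_zpow, BSlift_BSa, BSlift_BSt] at hc'
  let w : HNNExtension.NormalWord.ReducedWord (Multiplicative ℤ)
      (zpowGroupHom n : Multiplicative ℤ →* Multiplicative ℤ).range
      (zpowGroupHom m : Multiplicative ℤ →* Multiplicative ℤ).range :=
    { head := 1
      toList := [(1, Multiplicative.ofAdd k), (-1, Multiplicative.ofAdd 1),
        (1, Multiplicative.ofAdd (-k)), (-1, Multiplicative.ofAdd (-1))]
      chain := by
        simp only [List.isChain_cons_cons, List.isChain_singleton,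
          HNNExtension.toSubgroup_one, HNNExtension.toSubgroup_neg_one, hmem, dvd_neg, hm1, hnk,
          false_implies, and_self] }
  have hw : w.prod e = 1 := by
    have : w.prod e = t * a ^ k * t⁻¹ * a * (t * a ^ k * t⁻¹)⁻¹ * a⁻¹ := by
      simp only [HNNExtension.NormalWord.ReducedWord.prod, w, List.map, List.prod_cons, hof]
      simp [t, mul_assoc]
    rw [this, hc'.eq]
    group
  have := HNNExtension.ReducedWord.toList_eq_nil_of_mem_of_range e w (hw ▸ one_mem _)
  simp [w] at this

theorem not_residuallyFinite_BS {m n : ℤ} (hm : 1 < m) (hmn : m < |n|) :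
    ¬ ResiduallyFinite (BS m n) := by
  intro hRF
  have hn : n ≠ 0 := by rintro rfl; simp at hmn; omega
  have hm1 : ¬ m ∣ 1 := fun h => by have := Int.le_of_dvd one_pos h; omega
  have hng : ¬ n ∣ (Int.gcd m n : ℤ) := fun h => by
    have := Int.le_of_dvd (by omega) ((abs_dvd n m).mpr (h.trans (Int.gcd_dvd_left ..)))
    omega
  obtain ⟨G, _, _, σ, -, hσ⟩ := hRF _ _ (conj_zpow_not_commute (by omega) hn hm1 hng)
  have hrel := congrArg σ (BSt_inv_mul_BSa_zpow_mul_BSt m n)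
  simp only [map_mul, map_inv, map_zpow] at hrel
  obtain ⟨j, hj⟩ := conj_zpow_gcd_mem_zpowers hrel
  apply hσ
  simp only [map_mul, map_inv, map_zpow, ← hj]
  exact ((Commute.refl _).zpow_left j).eq

/-! ### Finite quotients detecting particular elements -/

/-- The powers of `a` survive in the affine groups over `ℤ/p`, where `a` acts by translation
and `t` by multiplication by `m / n`. -/
theorem exists_finite_BSa_zpow_ne_one {m n k : ℤ} (hm : m ≠ 0) (hn : n ≠ 0) (hk : k ≠ 0) :
    ∃ (G : Type) (_ : Group G), Finite G ∧ ∃ σ : BS m n →* G, σ (BSa m n ^ k) ≠ 1 := by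
  obtain ⟨p, hle, hp⟩ := Nat.exists_infinite_primes ((m * n * k).natAbs + 1)
  have : Fact p.Prime := ⟨hp⟩
  have hne : ((m * n * k : ℤ) : ZMod p) ≠ 0 := by
    rw [Ne, ZMod.intCast_zmod_eq_zero_iff_dvd]
    intro h
    have := Nat.le_of_dvd (by simp [hm, hn, hk]) (Int.natAbs_dvd_natAbs.mpr h)
    simp only [Int.natAbs_natCast] at this
    omega
  push_cast at hne
  have hm' : (m : ZMod p) ≠ 0 := fun h => hne (by simp [h])
  have hn' : (n : ZMod p) ≠ 0 := fun h => hne (by simp [h])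
  have hk' : (k : ZMod p) ≠ 0 := fun h => hne (by simp [h])
  let α : Equiv.Perm (ZMod p) := Equiv.addLeft 1
  let τ : Equiv.Perm (ZMod p) := Equiv.mulLeft₀ (m / n : ZMod p) (div_ne_zero hm' hn')
  have hα (j : ℤ) (x : ZMod p) : (α ^ j) x = j + x := by
    simp [α]
  have hrel : τ⁻¹ * α ^ m * τ = α ^ n := by
    rw [mul_assoc, inv_mul_eq_iff_eq_mul]
    ext1 x
    simp only [Equiv.Perm.mul_apply, hα]
    change (m : ZMod p) + m / n * x = m / n * (n + x)
    field_simp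
  refine ⟨Equiv.Perm (ZMod p), inferInstance, inferInstance, BSlift hrel, fun h => hk' ?_⟩
  have := Equiv.congr_fun h 0
  simpa [hα] using this

theorem exists_finite_ne_one_of_exponent {m n : ℤ} {g : BS m n}
    (hg : BSlift (a := (1 : Multiplicative ℤ)) (t := Multiplicative.ofAdd 1) (m := m) (n := n)
      (by simp) g ≠ 1) :
    ∃ (G : Type) (_ : Group G), Finite G ∧ ∃ σ : BS m n →* G, σ g ≠ 1 := by
  set x := BSlift (a := (1 : Multiplicative ℤ)) (t := Multiplicative.ofAdd 1) (m := m) (n := n)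
      (by simp) g with hx
  have hx0 : x.toAdd ≠ 0 := hg
  have : NeZero (x.toAdd.natAbs + 1) := ⟨by omega⟩
  refine ⟨Multiplicative (ZMod (x.toAdd.natAbs + 1)), inferInstance, inferInstance,
    (AddMonoidHom.toMultiplicative (Int.castAddHom (ZMod (x.toAdd.natAbs + 1)))).comp
      (BSlift (a := (1 : Multiplicative ℤ)) (t := Multiplicative.ofAdd 1) (by simp)), ?_⟩
  intro h
  rw [MonoidHom.comp_apply, ← hx] at h
  have h0 : ((x.toAdd : ℤ) : ZMod (x.toAdd.natAbs + 1)) = 0 := h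
  rw [ZMod.intCast_zmod_eq_zero_iff_dvd] at h0
  have := Nat.le_of_dvd (by omega) (Int.natAbs_dvd_natAbs.mpr h0)
  simp only [Int.natAbs_natCast] at this
  omega

/-! ### The case `m = 1` -/

theorem BS_one_exists_eq (n : ℤ) (g : BS 1 n) :
    ∃ (i j : ℕ) (k : ℤ), g = BSt 1 n ^ i * BSa 1 n ^ k * (BSt 1 n ^ j)⁻¹ := by
  set a := BSa 1 n with ha
  set t := BSt 1 n with ht
  have hrel : t⁻¹ * a * t = a ^ n := by
    simpa using BSt_inv_mul_BSa_zpow_mul_BSt 1 n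
  have hconj (k : ℤ) : t⁻¹ * a ^ k = a ^ (n * k) * t⁻¹ := by
    rw [zpow_mul, ← hrel]
    have := conj_zpow (i := k) (a := t⁻¹) (b := a)
    rw [inv_inv] at this
    rw [this]
    group
  have hpow (i : ℕ) : ∀ k : ℤ, a ^ k * t ^ i = t ^ i * a ^ (n ^ i * k) := by
    induction i with
    | zero => simp
    | succ i ih =>
      intro k
      have h1 : a ^ k * t = t * a ^ (n * k) := by
        rw [← inv_mul_eq_iff_eq_mul, ← mul_assoc, hconj]
        group
      rw [pow_succ', ← mul_assoc, h1, mul_assoc, ih, mul_assoc]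
      ring_nf
  have hcl : g ∈ Subgroup.closure {a, t} := by
    rw [closure_BSa_BSt]
    exact Subgroup.mem_top g
  have hamul (k : ℤ) (y : BS 1 n) (hy : ∃ (i j : ℕ) (k : ℤ), y = t ^ i * a ^ k * (t ^ j)⁻¹) :
      ∃ (i j : ℕ) (l : ℤ), a ^ k * y = t ^ i * a ^ l * (t ^ j)⁻¹ := by
    obtain ⟨i, j, l, rfl⟩ := hy
    exact ⟨i, j, n ^ i * k + l, by rw [zpow_add, ← mul_assoc, ← mul_assoc, hpow, mul_assoc (t ^ i)]⟩
  induction hcl using Subgroup.closure_induction_left with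
  | one => exact ⟨0, 0, 0, by simp⟩
  | mul_left x hx y _ ih =>
    obtain rfl | rfl := hx
    · simpa using hamul 1 y ih
    · obtain ⟨i, j, l, rfl⟩ := ih
      exact ⟨i + 1, j, l, by rw [pow_succ', mul_assoc, mul_assoc, mul_assoc]⟩
  | inv_mul_cancel x hx y _ ih =>
    obtain rfl | rfl := hx
    · simpa using hamul (-1) y ih
    · obtain ⟨i, j, l, rfl⟩ := ih
      cases i with
      | zero =>
        refine ⟨0, j + 1, n * l, ?_⟩
        rw [pow_zero, one_mul, one_mul, ← mul_assoc, hconj, pow_succ, mul_inv_rev, mul_assoc]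
      | succ i => exact ⟨i, j, l, by rw [pow_succ']; group⟩

theorem residuallyFinite_BS_one {n : ℤ} (hn : n ≠ 0) : ResiduallyFinite (BS 1 n) := by
  refine residuallyFinite_of_forall_ne_one fun g hg => ?_
  obtain ⟨i, j, k, rfl⟩ := BS_one_exists_eq n g
  by_cases hij : i = j
  · subst hij
    have hk : k ≠ 0 := by
      rintro rfl
      simp at hg
    obtain ⟨G, _, hG, σ, hσ⟩ := exists_finite_BSa_zpow_ne_one one_ne_zero hn hk
    refine ⟨G, inferInstance, hG, σ, ?_⟩
    simpa [mul_inv_eq_one] using hσ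
  · apply exists_finite_ne_one_of_exponent
    intro h
    have := congrArg Multiplicative.toAdd h
    simp at this
    omega

/-! ### The case `|n| = m` -/

/-- The set `S` carries a permutation agreeing with left multiplication by `c`
wherever the latter stays in `S`. -/
theorem exists_perm_extending_mul {Q : Type*} [Group Q] (S : Set Q) [Finite S] (c : Q) :
    ∃ τ : Equiv.Perm S, ∀ x : S, c * x ∈ S → (τ x : Q) = c * x := by
  classical
  have := Fintype.ofFinite S
  let e : {x : S // c * x ∈ S} ≃ {x : S // c⁻¹ * x ∈ S} :=
    { toFun := fun x => ⟨⟨c * x.1, x.2⟩, by simp⟩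
      invFun := fun x => ⟨⟨c⁻¹ * x.1, x.2⟩, by simp⟩
      left_inv := fun x => by simp
      right_inv := fun x => by simp }
  exact ⟨e.extendSubtype, fun x hx => by rw [e.extendSubtype_apply_of_mem x hx]; rfl⟩

/-- A word in the `c b` traces a finite path from `x`; permutations of a set containing this
path that extend the left multiplications by the `c b` act on `x` as the word does. -/
theorem exists_finite_path {Q : Type*} [Group Q] {ι : Type*} (c : ι → Q) (w : FreeGroup ι) :
    ∀ x : Q, ∃ P : Set Q, P.Finite ∧ ∀ (S : Set Q) (ρ : ι → Equiv.Perm S),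
      (∀ b (y : S), c b * y ∈ S → (ρ b y : Q) = c b * y) → P ⊆ S →
      ∃ hx : x ∈ S, (FreeGroup.lift ρ w ⟨x, hx⟩ : Q) = FreeGroup.lift c w * x := by
  induction w using FreeGroup.induction_on with
  | C1 => exact fun x => ⟨{x}, Set.finite_singleton x, fun S ρ _ hP => ⟨by simpa using hP, by simp⟩⟩
  | of b =>
    refine fun x => ⟨{x, c b * x}, by simp, fun S ρ hρ hP => ?_⟩
    simp only [Set.insert_subset_iff, Set.singleton_subset_iff] at hP
    exact ⟨hP.1, by simpa using hρ b ⟨x, hP.1⟩ hP.2⟩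
  | inv_of b _ =>
    refine fun x => ⟨{x, (c b)⁻¹ * x}, by simp, fun S ρ hρ hP => ?_⟩
    simp only [Set.insert_subset_iff, Set.singleton_subset_iff] at hP
    refine ⟨hP.1, ?_⟩
    have h : ρ b ⟨_, hP.2⟩ = ⟨x, hP.1⟩ := by
      ext1
      rw [hρ b _ (by simpa using hP.1)]
      simp
    simp only [map_inv, FreeGroup.lift_apply_of, ← h, Equiv.Perm.inv_def, Equiv.symm_apply_apply]
  | mul v w hv hw =>
    intro x
    obtain ⟨P₁, hP₁, h₁⟩ := hw x
    obtain ⟨P₂, hP₂, h₂⟩ := hv (FreeGroup.lift c w * x)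
    refine ⟨P₁ ∪ P₂, hP₁.union hP₂, fun S ρ hρ hP => ?_⟩
    obtain ⟨hx, hwx⟩ := h₁ S ρ hρ (Set.subset_union_left.trans hP)
    obtain ⟨hy, hvy⟩ := h₂ S ρ hρ (Set.subset_union_right.trans hP)
    refine ⟨hx, ?_⟩
    have : FreeGroup.lift ρ w ⟨x, hx⟩ = ⟨_, hy⟩ := Subtype.ext hwx
    rw [map_mul, Equiv.Perm.mul_apply, this, hvy, map_mul, mul_assoc]

open scoped Pointwise in
/-- Free products of a finite cyclic group and an infinite cyclic group are residually finite:
a word that is nontrivial for a pair `a, t` with `a ^ m = 1` is nontrivial for such a pair in a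
finite group. -/
theorem exists_finite_perm_lift_ne_one {Q : Type} [Group Q] {c : Bool → Q} {m : ℕ} (hm : 0 < m)
    (hc : c false ^ m = 1) {w : FreeGroup Bool} (hw : FreeGroup.lift c w ≠ 1) :
    ∃ (G : Type) (_ : Group G), Finite G ∧ ∃ ρ : Bool → G, ρ false ^ m = 1 ∧
      FreeGroup.lift ρ w ≠ 1 := by
  obtain ⟨P, hP, h⟩ := exists_finite_path c w 1
  have hfin : IsOfFinOrder (c false) := isOfFinOrder_iff_pow_eq_one.mpr ⟨m, hm, hc⟩
  let S : Set Q := (Subgroup.zpowers (c false) : Set Q) * P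
  have hS : S.Finite := Set.Finite.mul (by simpa using hfin) hP
  have : Finite S := hS
  have hPS : P ⊆ S := fun x hx => ⟨1, one_mem _, x, hx, one_mul x⟩
  have haS (x : S) : c false * x ∈ S := by
    obtain ⟨_, y, hy, z, hz, rfl⟩ := x
    exact ⟨c false * y, mul_mem (Subgroup.mem_zpowers _) hy, z, hz, mul_assoc _ _ _⟩
  choose ρ hρ using fun b => exists_perm_extending_mul S (c b)
  have hpow (j : ℕ) (x : S) : ((ρ false ^ j) x : Q) = c false ^ j * x := by
    induction j with
    | zero => simp
    | succ j ih => rw [pow_succ', Equiv.Perm.mul_apply, hρ _ _ (haS _), ih, pow_succ', mul_assoc]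
  refine ⟨Equiv.Perm S, inferInstance, inferInstance, ρ, ?_, fun h1 => hw ?_⟩
  · ext x
    simp [hpow, hc]
  · obtain ⟨hx, h2⟩ := h S ρ hρ hPS
    simpa [h1] using h2.symm

theorem residuallyFinite_BS_of_abs_eq {m n : ℤ} (hm : 0 < m) (hmn : m = |n|) :
    ResiduallyFinite (BS m n) := by
  have hn : n ≠ 0 := by rintro rfl; simp at hmn; omega
  have hn' : n = m ∨ n = -m := by
    obtain h | h := abs_choice n <;> omega
  lift m to ℕ using hm.le
  set a := BSa m n
  set t := BSt m n
  have hrel : t⁻¹ * a ^ (m : ℤ) * t = a ^ n := BSt_inv_mul_BSa_zpow_mul_BSt m n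
  have hzn : Subgroup.zpowers (a ^ n) = Subgroup.zpowers (a ^ (m : ℤ)) := by
    obtain rfl | rfl := hn'
    · rfl
    · rw [zpow_neg, Subgroup.zpowers_inv]
  let N := Subgroup.zpowers (a ^ (m : ℤ))
  have hN : N.Normal := by
    rw [← Subgroup.normalizer_eq_top_iff, eq_top_iff, ← closure_BSa_BSt, Subgroup.closure_le]
    have hconj {g x y : BS m n} (h : g * x * g⁻¹ = y) :
        (Subgroup.zpowers x).map (MulAut.conj g).toMonoidHom = Subgroup.zpowers y := by
      rw [MonoidHom.map_zpowers]
      exact congrArg _ h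
    have ha : a ∈ Subgroup.normalizer (N : Set (BS m n)) :=
      Subgroup.mem_normalizer_iff_map_conj_eq.mpr (hconj (by group))
    have ht : t⁻¹ ∈ Subgroup.normalizer (N : Set (BS m n)) :=
      Subgroup.mem_normalizer_iff_map_conj_eq.mpr
        ((hconj (by rw [inv_inv, hrel])).trans hzn)
    rintro x (rfl | rfl)
    exacts [ha, inv_mem_iff.mp ht]
  refine residuallyFinite_of_forall_ne_one fun g hg => ?_
  by_cases hgN : g ∈ N
  · obtain ⟨k, rfl⟩ := hgN
    simp only [← zpow_mul] at hg ⊢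
    refine exists_finite_BSa_zpow_ne_one hm.ne' hn fun h => hg ?_
    rw [h, zpow_zero]
  · obtain ⟨w, rfl⟩ := PresentedGroup.mk_surjective _ g
    let c : Bool → BS m n ⧸ N := fun b => QuotientGroup.mk' N (PresentedGroup.of b)
    have hc : FreeGroup.lift c = (QuotientGroup.mk' N).comp (PresentedGroup.mk (BSrels m n)) :=
      FreeGroup.ext_hom _ _ fun b => FreeGroup.lift_apply_of
    have hw : FreeGroup.lift c w ≠ 1 := by
      rw [hc]
      exact mt (QuotientGroup.eq_one_iff _).mp hgN
    have hcm : c false ^ m = 1 := by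
      have h : a ^ m ∈ N := zpow_natCast a m ▸ Subgroup.mem_zpowers (a ^ (m : ℤ))
      exact (QuotientGroup.eq_one_iff _).mpr h
    obtain ⟨G, _, hG, ρ, hρ, hne⟩ := exists_finite_perm_lift_ne_one (by exact_mod_cast hm) hcm hw
    have hrelG : (ρ true)⁻¹ * ρ false ^ (m : ℤ) * ρ true = ρ false ^ n := by
      obtain rfl | rfl := hn' <;> simp [hρ]
    have hl : FreeGroup.lift ρ = (BSlift hrelG).comp (PresentedGroup.mk (BSrels m n)) := by
      refine FreeGroup.ext_hom _ _ fun b => ?_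
      rw [FreeGroup.lift_apply_of]
      cases b
      · exact (BSlift_BSa hrelG).symm
      · exact (BSlift_BSt hrelG).symm
    exact ⟨G, inferInstance, hG, BSlift hrelG, by rwa [hl] at hne⟩

/-- `BS(m,n)` with `0 < m ≤ |n|` is residually finite iff `m = 1` or `m = |n|`. -/
theorem stmt9 (m n : ℤ) (hm : 0 < m) (hmn : m ≤ |n|) :
    ResiduallyFinite (BS m n) ↔ (m = 1 ∨ m = |n|) := by
  constructor
  · intro h
    by_contra! hne
    exact not_residuallyFinite_BS (by omega) (lt_of_le_of_ne hmn hne.2) h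
  · rintro (rfl | h)
    · exact residuallyFinite_BS_one (by rintro rfl; simp at hmn)
    · exact residuallyFinite_BS_of_abs_eq hm h
end

section
/- Let m,n ∈ ℤ with 0 < m ≤ |n|. If the Baumslag–Solitar group BS(m,n) is residually finite, then BS(m,n) is conjugacy separable. -/
namespace BaumslagSolitar

section Presentation

variable {m n : ℤ} {G : Type*} [Group G]

theorem relation (m n : ℤ) : (BSt m n)⁻¹ * BSa m n ^ m * BSt m n = BSa m n ^ n := by
  have h : PresentedGroup.mk (BSrels m n) ((FreeGroup.of true)⁻¹ * (FreeGroup.of false) ^ m *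
      FreeGroup.of true * (FreeGroup.of false) ^ (-n)) = 1 :=
    PresentedGroup.one_of_mem rfl
  simp only [map_mul, map_inv, map_zpow, zpow_neg] at h
  exact mul_inv_eq_one.mp h

/-- The homomorphism out of `BS(m,n)` given by the images of the two generators. -/
def lift (A T : G) (h : T⁻¹ * A ^ m * T = A ^ n) : BS m n →* G :=
  PresentedGroup.toGroup (f := fun b => bif b then T else A) (by
    rintro r rfl
    simp [h])

@[simp]
theorem lift_a (A T : G) (h : T⁻¹ * A ^ m * T = A ^ n) : lift A T h (BSa m n) = A :=
  PresentedGroup.toGroup.of _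

@[simp]
theorem lift_t (A T : G) (h : T⁻¹ * A ^ m * T = A ^ n) : lift A T h (BSt m n) = T :=
  PresentedGroup.toGroup.of _

theorem closure_generators (m n : ℤ) : Subgroup.closure {BSa m n, BSt m n} = ⊤ := by
  have h := PresentedGroup.closure_range_of (BSrels m n)
  have hr : Set.range (PresentedGroup.of : Bool → PresentedGroup (BSrels m n)) =
      {BSa m n, BSt m n} := by
    ext x
    simp only [Set.mem_range, Bool.exists_bool]
    exact or_congr eq_comm eq_comm
  rwa [hr] at h

/-- A property of the identity that is stable under left multiplication by the generators and their
inverses holds everywhere. -/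
theorem induction_left {p : BS m n → Prop} (one : p 1)
    (mul_a : ∀ x, p x → p (BSa m n * x)) (inv_a_mul : ∀ x, p x → p ((BSa m n)⁻¹ * x))
    (mul_t : ∀ x, p x → p (BSt m n * x)) (inv_t_mul : ∀ x, p x → p ((BSt m n)⁻¹ * x))
    (x : BS m n) : p x := by
  have hx : x ∈ Subgroup.closure {BSa m n, BSt m n} := by simp [closure_generators]
  induction hx using Subgroup.closure_induction_left with
  | one => exact one
  | mul_left x hx y _ hy =>
    rcases hx with rfl | rfl
    · exact mul_a y hy
    · exact mul_t y hy
  | inv_mul_cancel x hx y _ hy =>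
    rcases hx with rfl | rfl
    · exact inv_a_mul y hy
    · exact inv_t_mul y hy

end Presentation

section Separation

variable {X : Type} [Group X]

/-- Some homomorphism to a finite group maps `x` and `y` to elements that are not conjugate in the
image. -/
def Separated (x y : X) : Prop :=
  ∃ (F : Type) (_ : Group F), Finite F ∧ ∃ σ : X →* F, ∀ g, σ (g * x * g⁻¹) ≠ σ y

theorem Separated.exists_surjective {x y : X} (h : Separated x y) :
    ∃ (G : Type) (_ : Group G), Finite G ∧
      ∃ σ : X →* G, Function.Surjective σ ∧ ¬IsConj (σ x) (σ y) := by
  obtain ⟨F, _, _, σ, hσ⟩ := h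
  refine ⟨σ.range, inferInstance, inferInstance, σ.rangeRestrict, σ.rangeRestrict_surjective, ?_⟩
  intro hc
  obtain ⟨c, hc⟩ := isConj_iff.mp hc
  obtain ⟨g, rfl⟩ := σ.rangeRestrict_surjective c
  apply hσ g
  simpa [Subtype.ext_iff] using hc

theorem Separated.symm {x y : X} (h : Separated x y) : Separated y x := by
  obtain ⟨F, _, _, σ, hσ⟩ := h
  refine ⟨F, inferInstance, inferInstance, σ, fun g hg => hσ g⁻¹ ?_⟩
  simp only [map_mul, map_inv] at hg ⊢
  rw [← hg]
  group

theorem Separated.of_isConj {x x' y y' : X} (h : Separated x y) (hx : IsConj x x')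
    (hy : IsConj y y') : Separated x' y' := by
  obtain ⟨F, _, _, σ, hσ⟩ := h
  obtain ⟨c, rfl⟩ := isConj_iff.mp hx
  obtain ⟨d, rfl⟩ := isConj_iff.mp hy
  refine ⟨F, inferInstance, inferInstance, σ, fun g hg => hσ (d⁻¹ * g * c) ?_⟩
  have : σ y = σ d⁻¹ * σ (d * y * d⁻¹) * σ d := by simp only [map_mul, map_inv]; group
  rw [this, ← hg]
  simp only [map_mul, map_inv]
  group

/-- Homomorphisms to finite groups separate conjugacy classes as soon as they do so for
representatives. -/
theorem conjugacySeparable_of_representatives (R : Set X) (hR : ∀ x, ∃ r ∈ R, IsConj x r)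
    (h : ∀ x ∈ R, ∀ y ∈ R, ¬IsConj x y → Separated x y) : ConjugacySeparable X := by
  intro x y hxy
  obtain ⟨r, hr, hxr⟩ := hR x
  obtain ⟨s, hs, hys⟩ := hR y
  refine Separated.exists_surjective ((h r hr s hs fun hrs => hxy ?_).of_isConj hxr.symm hys.symm)
  exact (hxr.trans hrs).trans hys.symm

end Separation

section NotResiduallyFinite

theorem exists_zpow_eq_of_isConj_zpow {F : Type*} [Group F] [Finite F] {A T : F} {m n : ℤ}
    (h : T⁻¹ * A ^ m * T = A ^ n) : ∃ k : ℤ, A ^ m = (A ^ n) ^ k := by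
  have hord : orderOf (A ^ m) = orderOf (A ^ n) := by
    rw [← h]
    simpa using (orderOf_injective (MulAut.conj T⁻¹).toMonoidHom (MulAut.conj T⁻¹).injective
      (A ^ m)).symm
  have hcard : ∀ k : ℤ, orderOf (A ^ k) * Int.gcd (orderOf A) k = orderOf A := by
    intro k
    have hk : orderOf (A ^ k) = orderOf (A ^ k.natAbs) := by
      obtain ⟨j, rfl | rfl⟩ := k.eq_nat_or_neg <;> simp
    rw [hk, orderOf_pow]
    exact Nat.div_mul_cancel (Nat.gcd_dvd_left _ _)
  have hgcd : Int.gcd (orderOf A) m = Int.gcd (orderOf A) n := by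
    have h1 := (hcard m).trans (hcard n).symm
    rw [hord] at h1
    exact Nat.eq_of_mul_eq_mul_left (orderOf_pos _) h1
  obtain ⟨c, hc⟩ : (Int.gcd (orderOf A) n : ℤ) ∣ m := hgcd ▸ Int.gcd_dvd_right _ _
  refine ⟨Int.gcdB (orderOf A) n * c, ?_⟩
  rw [hc, Int.gcd_eq_gcd_ab, add_mul, zpow_add, mul_assoc, zpow_mul, zpow_natCast,
    pow_orderOf_eq_one, one_zpow, one_mul, mul_assoc, zpow_mul]

theorem commute_conj_of_finite {F : Type*} [Group F] [Finite F] {A T : F} {m n : ℤ}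
    (h : T⁻¹ * A ^ m * T = A ^ n) : Commute (T * A ^ m * T⁻¹) A := by
  obtain ⟨k, hk⟩ := exists_zpow_eq_of_isConj_zpow h
  have : T * A ^ m * T⁻¹ = A ^ (m * k) := by
    rw [hk, ← conj_zpow, ← h, zpow_mul]
    group
  rw [this]
  exact (Commute.refl A).zpow_left _

/-- The isomorphism of `mℤ` with `nℤ` taking `m` to `n`, in multiplicative notation. -/
noncomputable def powEquiv (m n : ℤ) (hm : m ≠ 0) (hn : n ≠ 0) :
    (zpowGroupHom m : Multiplicative ℤ →* Multiplicative ℤ).range ≃*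
      (zpowGroupHom n : Multiplicative ℤ →* Multiplicative ℤ).range :=
  (MonoidHom.ofInjective (zpow_left_injective hm)).symm.trans
    (MonoidHom.ofInjective (zpow_left_injective hn))

theorem not_commute_conj {m n : ℤ} (hm : 1 < m) (hmn : m < |n|) :
    ¬Commute (BSt m n * BSa m n ^ m * (BSt m n)⁻¹) (BSa m n) := by
  have hm0 : m ≠ 0 := by omega
  have hn0 : n ≠ 0 := by rintro rfl; simp at hmn; omega
  let φ := powEquiv m n hm0 hn0
  let a : Multiplicative ℤ := Multiplicative.ofAdd 1
  let A : HNNExtension _ _ _ φ := HNNExtension.of a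
  let T : HNNExtension _ _ _ φ := HNNExtension.t
  have hrel : (T⁻¹)⁻¹ * A ^ m * T⁻¹ = A ^ n := by
    have h := HNNExtension.equiv_eq_conj (φ := φ) (MonoidHom.ofInjective (zpow_left_injective hm0) a)
    have h2 : φ (MonoidHom.ofInjective (zpow_left_injective hm0) a) =
      MonoidHom.ofInjective (zpow_left_injective hn0) a := by simp [φ, powEquiv]
    rw [h2] at h
    have h3 : HNNExtension.of (φ := φ) (a ^ n) = T * HNNExtension.of (a ^ m) * T⁻¹ := h
    have hA : ∀ k : ℤ, HNNExtension.of (φ := φ) (a ^ k) = A ^ k := fun k => map_zpow _ a k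
    rw [hA, hA] at h3
    rw [inv_inv, h3]
  intro hc
  replace hc := hc.map (lift A T⁻¹ hrel)
  simp only [map_mul, map_inv, map_zpow, lift_a, lift_t, inv_inv] at hc
  have ha : ∀ k l : ℤ, a ^ k ∈ (zpowGroupHom l : Multiplicative ℤ →* Multiplicative ℤ).range →
      l ∣ k := by
    rintro k l ⟨x, hx⟩
    have := congrArg Multiplicative.toAdd hx
    simp [a] at this
    exact ⟨_, this.symm⟩
  have hmn' : ¬n ∣ m := fun hd => by
    have := Int.le_of_dvd (by omega) ((abs_dvd n m).mpr hd)
    omega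
  have hm1 : ¬m ∣ 1 := fun hd => by
    have := Int.le_of_dvd one_pos hd
    omega
  let w : HNNExtension.NormalWord.ReducedWord (Multiplicative ℤ) _ _ :=
    { head := 1
      toList := [(-1, a ^ m), (1, a), (-1, a ^ (-m)), (1, 1)]
      chain := by
        simp only [List.isChain_cons_cons, List.isChain_singleton, and_true]
        refine ⟨fun h => absurd (ha m n h) hmn', fun h => absurd (ha 1 m ((zpow_one a).symm ▸ h)) hm1,
          fun h => absurd (ha (-m) n h) (by rwa [dvd_neg])⟩ }
  have hw : w.prod φ ∈ (HNNExtension.of (φ := φ)).range := by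
    refine ⟨a, ?_⟩
    have hcomm : T⁻¹ * A ^ m * T * A * (T⁻¹ * A ^ m * T)⁻¹ = A := by rw [hc.eq]; group
    calc HNNExtension.of a = T⁻¹ * A ^ m * T * A * (T⁻¹ * A ^ m * T)⁻¹ := hcomm.symm
      _ = w.prod φ := by
        simp [w, HNNExtension.NormalWord.ReducedWord.prod, A, T, mul_assoc]
  simpa [w] using HNNExtension.ReducedWord.toList_eq_nil_of_mem_of_range φ w hw

theorem eq_one_or_abs_eq_of_residuallyFinite {m n : ℤ} (hm : 0 < m) (hmn : m ≤ |n|)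
    (h : ResiduallyFinite (BS m n)) : m = 1 ∨ |n| = m := by
  by_contra! hne
  have hnc := not_commute_conj (m := m) (n := n) (by omega) (by omega)
  obtain ⟨F, _, _, σ, -, hσ⟩ := h _ _ hnc
  apply hσ
  have hF := commute_conj_of_finite (A := σ (BSa m n)) (T := σ (BSt m n)) (m := m) (n := n) (by
    simp only [← map_inv, ← map_zpow, ← map_mul, relation])
  simpa [Commute, SemiconjBy] using hF

end NotResiduallyFinite

section TExponent

variable {m n : ℤ}

theorem exists_tExponent (m n : ℤ) (N : ℕ) :
    ∃ f : BS m n →* Multiplicative (ZMod N),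
      f (BSa m n) = 1 ∧ f (BSt m n) = Multiplicative.ofAdd 1 :=
  ⟨lift 1 (Multiplicative.ofAdd 1) (by simp), by simp, by simp⟩

theorem separated_of_tExponent_ne {i j k l : ℤ} (h : k ≠ l) :
    Separated (BSa m n ^ i * BSt m n ^ k) (BSa m n ^ j * BSt m n ^ l) := by
  obtain ⟨f, hfa, hft⟩ := exists_tExponent m n ((k - l).natAbs + 1)
  refine ⟨_, _, inferInstanceAs (Finite (ZMod ((k - l).natAbs + 1))), f, fun g hg => h ?_⟩
  simp only [map_mul, map_zpow, hfa, hft, one_zpow, one_mul, map_inv, mul_inv_cancel_comm] at hg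
  rw [← ofAdd_zsmul, ← ofAdd_zsmul] at hg
  have hg' : ((k - l : ℤ) : ZMod ((k - l).natAbs + 1)) = 0 := by
    have := Multiplicative.ofAdd.injective hg
    simpa [sub_eq_zero] using this
  rw [ZMod.intCast_zmod_eq_zero_iff_dvd] at hg'
  have := Int.eq_zero_of_abs_lt_dvd hg' (by push_cast; omega)
  omega

end TExponent

section Metabelian

variable {n : ℤ}

local notation "a" => BSa 1 n
local notation "t" => BSt 1 n

theorem a_zpow_mul_t (i : ℤ) : a ^ i * t = t * a ^ (n * i) := by
  have h : t⁻¹ * a * t = a ^ n := by simpa using relation 1 n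
  rw [zpow_mul, ← h]
  have := (conj_zpow : (t⁻¹ * a * t⁻¹⁻¹) ^ i = _)
  rw [inv_inv] at this
  rw [this]
  group

theorem a_zpow_mul_t_pow (i : ℤ) (k : ℕ) : a ^ i * t ^ k = t ^ k * a ^ (n ^ k * i) := by
  induction k with
  | zero => simp
  | succ k ih =>
    rw [pow_succ, ← mul_assoc, ih, mul_assoc, a_zpow_mul_t, ← mul_assoc, pow_succ', mul_assoc n]

theorem exists_eq_t_pow_mul (x : BS 1 n) :
    ∃ (p q : ℕ) (i : ℤ), x = t ^ p * a ^ i * (t ^ q)⁻¹ := by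
  have ha : ∀ (j : ℤ) (x : BS 1 n), (∃ (p q : ℕ) (i : ℤ), x = t ^ p * a ^ i * (t ^ q)⁻¹) →
      ∃ (p q : ℕ) (i : ℤ), a ^ j * x = t ^ p * a ^ i * (t ^ q)⁻¹ := by
    rintro j _ ⟨p, q, i, rfl⟩
    refine ⟨p, q, n ^ p * j + i, ?_⟩
    rw [← mul_assoc, ← mul_assoc, a_zpow_mul_t_pow, zpow_add, mul_assoc (t ^ p)]
  induction x using induction_left with
  | one => exact ⟨0, 0, 0, by simp⟩
  | mul_a x hx => simpa using ha 1 x hx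
  | inv_a_mul x hx => simpa using ha (-1) x hx
  | mul_t x hx =>
    obtain ⟨p, q, i, rfl⟩ := hx
    exact ⟨p + 1, q, i, by rw [pow_succ']; group⟩
  | inv_t_mul x hx =>
    obtain ⟨p, q, i, rfl⟩ := hx
    cases p with
    | zero =>
      refine ⟨0, q + 1, n * i, ?_⟩
      have : t⁻¹ * a ^ i = a ^ (n * i) * t⁻¹ := by
        rw [inv_mul_eq_iff_eq_mul, ← mul_assoc, ← a_zpow_mul_t]
        group
      rw [pow_zero, one_mul, one_mul, ← mul_assoc, this, pow_succ, mul_inv_rev, mul_assoc]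
    | succ p => exact ⟨p, q, i, by rw [pow_succ']; group⟩

theorem exists_isConj_a_mul_t (x : BS 1 n) : ∃ i k : ℤ, IsConj x (a ^ i * t ^ k) := by
  obtain ⟨p, q, i, rfl⟩ := exists_eq_t_pow_mul x
  refine ⟨i, p - q, isConj_iff.mpr ⟨(t ^ p)⁻¹, ?_⟩⟩
  rw [show (p - q : ℤ) = -q + p by ring, zpow_add, zpow_neg, zpow_natCast, zpow_natCast]
  group

theorem isConj_pow_mul (i l : ℤ) (e : ℕ) : IsConj (a ^ i * t ^ l) (a ^ (n ^ e * i) * t ^ l) := by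
  refine isConj_iff.mpr ⟨(t ^ e)⁻¹, ?_⟩
  rw [inv_inv, mul_assoc, mul_assoc, inv_mul_eq_iff_eq_mul, ← mul_assoc (t ^ e), ← a_zpow_mul_t_pow]
  rw [mul_assoc, ← zpow_natCast, ← zpow_add, ← zpow_add, add_comm]

theorem isConj_add_mul (i c l : ℤ) :
    IsConj (a ^ i * t ^ l) (a ^ (i + (n ^ l.natAbs - 1) * c) * t ^ l) := by
  have h := a_zpow_mul_t_pow (n := n)
  obtain ⟨k, rfl | rfl⟩ := l.eq_nat_or_neg
  · refine isConj_iff.mpr ⟨a ^ (n ^ k * c), ?_⟩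
    have := h (-c) k
    rw [Int.natAbs_natCast, zpow_natCast, ← zpow_neg, mul_assoc, mul_assoc, ← mul_neg, ← this,
      ← mul_assoc, ← mul_assoc, ← zpow_add, ← zpow_add]
    ring_nf
  · refine isConj_iff.mpr ⟨a ^ (-c), ?_⟩
    have h1 : (t ^ k)⁻¹ * a ^ c = a ^ (n ^ k * c) * (t ^ k)⁻¹ := by
      rw [inv_mul_eq_iff_eq_mul, ← mul_assoc, ← h]
      group
    rw [Int.natAbs_neg, Int.natAbs_natCast, zpow_neg t, zpow_natCast, zpow_neg, inv_inv, mul_assoc,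
      mul_assoc, h1, ← mul_assoc, ← mul_assoc, ← zpow_neg, ← zpow_add, ← zpow_add]
    ring_nf

/-- The affine action of `BS(1,n)` on `ℤ/(nᵏ-1)`. -/
theorem exists_affine_action (n : ℤ) {k : ℕ} (hk : k ≠ 0) :
    ∃ σ : BS 1 n →* Equiv.Perm (ZMod (n ^ k - 1).natAbs),
      (∀ x, σ (BSa 1 n) x = x + 1) ∧ (∀ x, σ ((BSt 1 n) ^ k) x = x) ∧
      ∀ g, ∃ (e : ℕ) (c : ZMod (n ^ k - 1).natAbs), ∀ x, σ g x = n ^ e * x + c := by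
  obtain ⟨r, rfl⟩ := Nat.exists_eq_succ_of_ne_zero hk
  set M := (n ^ (r + 1) - 1).natAbs with hM
  have hn : (n : ZMod M) ^ (r + 1) = 1 := by
    have : ((n ^ (r + 1) - 1 : ℤ) : ZMod M) = 0 := by
      rw [ZMod.intCast_zmod_eq_zero_iff_dvd, hM, Int.natAbs_dvd]
    push_cast at this
    exact sub_eq_zero.mp this
  let A : Equiv.Perm (ZMod M) := Equiv.addRight 1
  let T : Equiv.Perm (ZMod M) :=
    { toFun := fun x => n ^ r * x
      invFun := fun x => n * x
      left_inv := fun x => by beta_reduce; rw [← mul_assoc, ← pow_succ', hn, one_mul]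
      right_inv := fun x => by beta_reduce; rw [← mul_assoc, ← pow_succ, hn, one_mul] }
  have hA : ∀ (i : ℤ) x, (A ^ i) x = x + i := by simp [A]
  have hTs : ∀ x, T⁻¹ x = n * x := fun x => rfl
  have hT : ∀ x, T x = n ^ r * x := fun x => rfl
  have hrel : T⁻¹ * A ^ (1 : ℤ) * T = A ^ n := by
    ext x
    rw [Equiv.Perm.mul_apply, Equiv.Perm.mul_apply, hA, hA, hTs, hT, mul_add, ← mul_assoc,
      ← pow_succ', hn]
    simp
  refine ⟨lift A T hrel, fun x => by simpa using hA 1 x, fun x => ?_, fun g => ?_⟩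
  · have : ∀ (j : ℕ) x, (T ^ j) x = (n ^ r) ^ j * x := by
      intro j
      induction j with
      | zero => simp
      | succ j ih =>
        intro x
        rw [pow_succ', Equiv.Perm.mul_apply, ih, hT, pow_succ' ((n : ZMod M) ^ r), mul_assoc]
    rw [map_pow, lift_t, this, ← pow_mul, mul_comm r, pow_mul, hn, one_pow, one_mul]
  · induction g using induction_left with
    | one => exact ⟨0, 0, by simp⟩
    | mul_a g ih =>
      obtain ⟨e, c, h⟩ := ih
      refine ⟨e, c + 1, fun x => ?_⟩
      have := hA 1 (n ^ e * x + c)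
      rw [zpow_one] at this
      rw [map_mul, Equiv.Perm.mul_apply, h, lift_a, this]
      simp [add_assoc]
    | inv_a_mul g ih =>
      obtain ⟨e, c, h⟩ := ih
      refine ⟨e, c + (-1), fun x => ?_⟩
      have := hA (-1) (n ^ e * x + c)
      rw [zpow_neg_one] at this
      rw [map_mul, Equiv.Perm.mul_apply, h, map_inv, lift_a, this]
      simp [add_assoc]
    | mul_t g ih =>
      obtain ⟨e, c, h⟩ := ih
      refine ⟨r + e, n ^ r * c, fun x => ?_⟩
      rw [map_mul, Equiv.Perm.mul_apply, h, lift_t, hT]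
      ring
    | inv_t_mul g ih =>
      obtain ⟨e, c, h⟩ := ih
      refine ⟨1 + e, n * c, fun x => ?_⟩
      rw [map_mul, Equiv.Perm.mul_apply, h, map_inv, lift_t, hTs]
      ring

theorem exists_modEq_of_not_separated (hn : 2 ≤ |n|) {i j l : ℤ} {k : ℕ} (hk : k ≠ 0)
    (hkl : (k : ℤ) ∣ l) (h : ¬Separated (a ^ i * t ^ l) (a ^ j * t ^ l)) :
    ∃ e < k, n ^ k - 1 ∣ j - n ^ e * i := by
  obtain ⟨σ, hσa, hσt, hσ⟩ := exists_affine_action n hk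
  have hM : (n ^ k - 1).natAbs ≠ 0 := by
    rw [Int.natAbs_ne_zero, sub_ne_zero]
    intro h1
    have h2 : |n| ^ k = 1 := by rw [← abs_pow, h1, abs_one]
    have := one_lt_pow₀ (show 1 < |n| by omega) hk
    omega
  have : NeZero (n ^ k - 1).natAbs := ⟨hM⟩
  have hσi : ∀ (i : ℤ) x, σ (a ^ i * t ^ l) x = x + i := by
    obtain ⟨d, rfl⟩ := hkl
    have h1 : σ (t ^ k) = 1 := Equiv.ext hσt
    have h2 : σ a = Equiv.addRight 1 := Equiv.ext hσa
    intro i x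
    rw [zpow_mul, zpow_natCast, map_mul, map_zpow, map_zpow, h1, h2]
    simp
  have hex : ∃ g, σ (g * (a ^ i * t ^ l) * g⁻¹) = σ (a ^ j * t ^ l) := by
    by_contra! hne
    exact h ⟨_, _, inferInstance, σ, hne⟩
  obtain ⟨g, hg⟩ := hex
  obtain ⟨e, c, hgc⟩ := hσ g
  have hmul : σ g * σ (a ^ i * t ^ l) = σ (a ^ j * t ^ l) * σ g := by
    rw [← hg, ← map_mul, ← map_mul, inv_mul_cancel_right]
  have h0 := Equiv.congr_fun hmul 0
  rw [Equiv.Perm.mul_apply, Equiv.Perm.mul_apply, hσi, hσi, hgc, hgc] at h0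
  have hnk : (n : ZMod (n ^ k - 1).natAbs) ^ k = 1 := by
    have : ((n ^ k - 1 : ℤ) : ZMod (n ^ k - 1).natAbs) = 0 := by
      rw [ZMod.intCast_zmod_eq_zero_iff_dvd, Int.natAbs_dvd]
    push_cast at this
    exact sub_eq_zero.mp this
  refine ⟨e % k, Nat.mod_lt _ (Nat.pos_of_ne_zero hk), ?_⟩
  rw [← Int.natAbs_dvd, ← ZMod.intCast_zmod_eq_zero_iff_dvd]
  push_cast
  rw [← pow_eq_pow_mod e hnk]
  linear_combination -h0

theorem eq_pow_mul_of_modEq (hn : 2 ≤ |n|) {i j : ℤ} {e L : ℕ} (hL : |i| + |j| + 2 ≤ L)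
    (he : e ≤ L) (h : n ^ (2 * L) - 1 ∣ j - n ^ e * i) : j = n ^ e * i := by
  have hpow : (L : ℤ) < |n| ^ L := by
    calc (L : ℤ) < 2 ^ L := mod_cast Nat.lt_two_pow_self
      _ ≤ |n| ^ L := pow_le_pow_left₀ (by norm_num) hn L
  have h1 : |n| ^ (2 * L) - 1 ≤ |n ^ (2 * L) - 1| := by
    have := abs_sub_abs_le_abs_sub (n ^ (2 * L)) 1
    rwa [abs_pow, abs_one] at this
  have h2 : |j - n ^ e * i| ≤ |j| + |n| ^ L * |i| := by
    refine (abs_sub _ _).trans ?_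
    rw [abs_mul, abs_pow]
    gcongr
    omega
  have hlt : |j - n ^ e * i| < |n ^ (2 * L) - 1| := by
    refine h2.trans_lt (lt_of_lt_of_le ?_ h1)
    rw [mul_comm 2, pow_mul]
    nlinarith [abs_nonneg i, abs_nonneg j]
  have := Int.eq_zero_of_abs_lt_dvd ((abs_dvd _ _).mpr h) hlt
  omega

theorem conjugacySeparable_one (hn : 2 ≤ |n|) : ConjugacySeparable (BS 1 n) := by
  refine conjugacySeparable_of_representatives {x | ∃ i k : ℤ, x = a ^ i * t ^ k}
    (fun x => ?_) ?_
  · obtain ⟨i, k, h⟩ := exists_isConj_a_mul_t x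
    exact ⟨_, ⟨i, k, rfl⟩, h⟩
  rintro _ ⟨i, l, rfl⟩ _ ⟨j, l', rfl⟩ hnc
  obtain hl | rfl := ne_or_eq l l'
  · exact separated_of_tExponent_ne hl
  by_contra hsep
  apply hnc
  obtain rfl | hl := eq_or_ne l 0
  · set L := (|i| + |j| + 2).toNat with hLdef
    have hL : |i| + |j| + 2 ≤ L := Int.self_le_toNat _
    have hL' : 0 < L := by
      have := abs_nonneg i
      have := abs_nonneg j
      omega
    obtain ⟨e, he, hdvd⟩ := exists_modEq_of_not_separated hn (k := 2 * L) (by omega)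
      (dvd_zero _) hsep
    obtain heL | heL := le_total e L
    · rw [eq_pow_mul_of_modEq hn hL heL hdvd]
      exact isConj_pow_mul i 0 e
    · have hdvd' : n ^ (2 * L) - 1 ∣ i - n ^ (2 * L - e) * j := by
        have hp : n ^ (2 * L - e) * n ^ e = n ^ (2 * L) := by
          rw [← pow_add, Nat.sub_add_cancel he.le]
        have : i - n ^ (2 * L - e) * j =
            -(n ^ (2 * L - e) * (j - n ^ e * i)) - (n ^ (2 * L) - 1) * i := by
          rw [← hp]
          ring
        rw [this]
        exact dvd_sub ((hdvd.mul_left _).neg_right) (dvd_mul_right _ _)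
      rw [eq_pow_mul_of_modEq hn (by omega) (by omega) hdvd']
      exact (isConj_pow_mul j 0 _).symm
  · obtain ⟨e, -, c, hc⟩ := exists_modEq_of_not_separated hn (k := l.natAbs) (by omega)
      (Int.natAbs_dvd.mpr dvd_rfl) hsep
    rw [show j = n ^ e * i + (n ^ l.natAbs - 1) * c by omega]
    exact (isConj_pow_mul i l e).trans (isConj_add_mul _ c l)

end Metabelian

section Unimodular

variable {m : ℕ} {ε : ℤˣ}

set_option hygiene false in
local notation "𝐆" => BS (m : ℤ) ((ε : ℤ) * (m : ℤ))
set_option hygiene false in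
local notation "𝐚" => BSa (m : ℤ) ((ε : ℤ) * (m : ℤ))
set_option hygiene false in
local notation "𝐭" => BSt (m : ℤ) ((ε : ℤ) * (m : ℤ))

variable (m ε) in
/-- The element `aᵐ`, which generates a normal subgroup of `BS(m,±m)`. -/
def power : 𝐆 := 𝐚 ^ (m : ℤ)

variable (m ε) in
/-- The character of `BS(m,εm)` by which the group acts on `⟨aᵐ⟩`. -/
def character : 𝐆 →* ℤˣ := lift 1 ε (by simp)

@[simp]
theorem character_a : character m ε 𝐚 = 1 := lift_a ..

@[simp]
theorem character_t : character m ε 𝐭 = ε := lift_t ..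

theorem zpow_units_sq {G : Type*} [Group G] (x : G) (u : ℤˣ) : (x ^ (u : ℤ)) ^ (u : ℤ) = x := by
  rw [← zpow_mul, ← Units.val_mul, ← sq, Int.units_sq, Units.val_one, zpow_one]

theorem inv_t_power_t : 𝐭⁻¹ * power m ε * 𝐭 = power m ε ^ (ε : ℤ) := by
  rw [power, relation, mul_comm, zpow_mul]

theorem t_power_inv_t : 𝐭 * power m ε * 𝐭⁻¹ = power m ε ^ (ε : ℤ) := by
  have h := congrArg (fun x => 𝐭 * x ^ (ε : ℤ) * 𝐭⁻¹) (inv_t_power_t (m := m) (ε := ε))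
  simp only [zpow_units_sq] at h
  rw [← h, ← conj_zpow]
  group

theorem conj_power (g : 𝐆) : g * power m ε * g⁻¹ = power m ε ^ (character m ε g : ℤ) := by
  have hmul : ∀ x g : 𝐆, ∀ u : ℤˣ, x * power m ε * x⁻¹ = power m ε ^ (u : ℤ) →
      character m ε x = u → g * power m ε * g⁻¹ = power m ε ^ (character m ε g : ℤ) →
      x * g * power m ε * (x * g)⁻¹ = power m ε ^ (character m ε (x * g) : ℤ) := by
    intro x g u hx hu hg
    calc x * g * power m ε * (x * g)⁻¹ = x * (g * power m ε * g⁻¹) * x⁻¹ := by group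
      _ = _ := by
        rw [hg, ← conj_zpow, hx, map_mul, hu, Units.val_mul, zpow_mul]
  induction g using induction_left with
  | one => simp
  | mul_a g ih => exact hmul _ _ 1 (by simp [power]; group) (by simp) ih
  | inv_a_mul g ih => exact hmul _ _ 1 (by simp [power]; group) (by simp) ih
  | mul_t g ih => exact hmul _ _ ε t_power_inv_t (by simp) ih
  | inv_t_mul g ih => exact hmul _ _ ε (by simpa using inv_t_power_t) (by simp) ih

theorem conj_by_power (v : 𝐆) (j : ℤ) :
    power m ε ^ (-j) * v * power m ε ^ j = v * power m ε ^ (j - (character m ε v : ℤ) * j) := by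
  have h := conj_power v⁻¹
  rw [map_inv, Int.units_inv_eq_self, inv_inv] at h
  have h2 : v⁻¹ * power m ε ^ (-j) * v = power m ε ^ (-((character m ε v : ℤ) * j)) := by
    have h3 := (conj_zpow : (v⁻¹ * power m ε * v⁻¹⁻¹) ^ (-j) = _)
    rw [inv_inv] at h3
    rw [← h3, h, ← zpow_mul, mul_neg]
  rw [sub_eq_neg_add, zpow_add, ← h2]
  group

variable (m ε) in
/-- The action of `BS(m,εm)` on `ℤ/N` in which `a` is a translation and `t` is multiplication by
`ε`. -/
theorem exists_dihedral_action (N : ℕ) :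
    ∃ κ : 𝐆 →* Equiv.Perm (ZMod N), (∀ (i : ℤ) x, κ (𝐚 ^ i) x = x + i) ∧
      ∀ g (i : ℤ) x, κ (g * 𝐚 ^ i * g⁻¹) x = x + ((character m ε g : ℤ) * i : ℤ) := by
  let A : Equiv.Perm (ZMod N) := Equiv.addRight 1
  have hε : ∀ x : ZMod N, ((ε : ℤ) : ZMod N) * (((ε : ℤ) : ZMod N) * x) = x := by
    intro x
    rw [← mul_assoc, ← Int.cast_mul, ← Units.val_mul, ← sq, Int.units_sq]
    simp
  let T : Equiv.Perm (ZMod N) := ⟨fun x => (ε : ℤ) * x, fun x => (ε : ℤ) * x, hε, hε⟩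
  have hA : ∀ (i : ℤ) x, (A ^ i) x = x + i := by simp [A]
  have hT : ∀ x, T x = (ε : ℤ) * x := fun x => rfl
  have hTs : ∀ x, T⁻¹ x = (ε : ℤ) * x := fun x => rfl
  have hrel : T⁻¹ * A ^ (m : ℤ) * T = A ^ ((ε : ℤ) * (m : ℤ)) := by
    ext x
    rw [Equiv.Perm.mul_apply, Equiv.Perm.mul_apply, hA, hA, hTs, hT, mul_add, hε]
    simp
  have hpow : ∀ (i : ℤ) x, lift A T hrel (𝐚 ^ i) x = x + i := by simp [hA]
  refine ⟨lift A T hrel, hpow, fun g => ?_⟩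
  induction g using induction_left with
  | one => simpa using hpow
  | mul_a g ih =>
    intro i x
    have : 𝐚 * g * 𝐚 ^ i * (𝐚 * g)⁻¹ = 𝐚 ^ (1 : ℤ) * (g * 𝐚 ^ i * g⁻¹) * 𝐚 ^ (-1 : ℤ) := by group
    rw [this, map_mul, map_mul, Equiv.Perm.mul_apply, Equiv.Perm.mul_apply, hpow, hpow, ih]
    simp
    ring
  | inv_a_mul g ih =>
    intro i x
    have : 𝐚⁻¹ * g * 𝐚 ^ i * (𝐚⁻¹ * g)⁻¹ = 𝐚 ^ (-1 : ℤ) * (g * 𝐚 ^ i * g⁻¹) * 𝐚 ^ (1 : ℤ) := by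
      group
    rw [this, map_mul, map_mul, Equiv.Perm.mul_apply, Equiv.Perm.mul_apply, hpow, hpow, ih]
    simp
    ring
  | mul_t g ih =>
    intro i x
    have : 𝐭 * g * 𝐚 ^ i * (𝐭 * g)⁻¹ = 𝐭 * (g * 𝐚 ^ i * g⁻¹) * 𝐭⁻¹ := by group
    rw [this, map_mul, map_mul, map_inv, lift_t, Equiv.Perm.mul_apply, Equiv.Perm.mul_apply, ih, hT,
      hTs, mul_add, hε, map_mul, character_t]
    push_cast
    rw [mul_assoc]
  | inv_t_mul g ih =>
    intro i x
    have : 𝐭⁻¹ * g * 𝐚 ^ i * (𝐭⁻¹ * g)⁻¹ = 𝐭⁻¹ * (g * 𝐚 ^ i * g⁻¹) * 𝐭 := by group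
    rw [this, map_mul, map_mul, map_inv, lift_t, Equiv.Perm.mul_apply, Equiv.Perm.mul_apply, ih, hT,
      hTs, mul_add, hε, map_mul, map_inv, character_t, Int.units_inv_eq_self]
    push_cast
    rw [mul_assoc]

variable (m) in
theorem exists_block_action (hε : ε = -1) :
    ∃ μ : 𝐆 →* Equiv.Perm (Bool × ZMod m),
      (∀ (i : ℤ) x, μ (𝐚 ^ i) (true, x) = (true, x)) ∧
      (∀ (i : ℤ) x, μ (𝐚 ^ i) (false, x) = (false, x + i)) ∧
      ∀ g, character m ε g = 1 ∧ (∀ p, (μ g p).1 = p.1) ∨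
        character m ε g = -1 ∧ ∀ p, (μ g p).1 = !p.1 := by
  let A : Equiv.Perm (Bool × ZMod m) := Equiv.prodShear (Equiv.refl _)
    fun b => bif b then Equiv.refl _ else Equiv.addRight 1
  let T : Equiv.Perm (Bool × ZMod m) := Equiv.prodCongr Equiv.boolNot (Equiv.refl _)
  have hAt : ∀ (i : ℤ) x, (A ^ i) (true, x) = (true, x) := by
    intro i x
    exact Equiv.Perm.zpow_apply_eq_self_of_apply_eq_self rfl i
  have hAf : ∀ (i : ℤ) x, (A ^ i) (false, x) = (false, x + i) := by
    intro i
    induction i with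
    | zero => simp
    | succ i ih =>
      intro x
      rw [zpow_add_one, Equiv.Perm.mul_apply]
      have : A (false, x) = (false, x + 1) := rfl
      rw [this, ih]
      push_cast
      ring_nf
    | pred i ih =>
      intro x
      rw [zpow_sub_one, Equiv.Perm.mul_apply]
      have : A⁻¹ (false, x) = (false, x - 1) := by
        rw [Equiv.Perm.inv_eq_iff_eq]
        simp [A]
      rw [this, ih]
      push_cast
      ring_nf
  have hAm : A ^ (m : ℤ) = 1 := by
    ext1 ⟨b, x⟩
    cases b <;> simp [hAt, hAf, -zpow_natCast]
  have hA1 : ∀ p, (A p).1 = p.1 := fun p => rfl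
  have hA1' : ∀ p, (A⁻¹ p).1 = p.1 := fun p => by
    rw [← hA1, ← Equiv.Perm.mul_apply, mul_inv_cancel, Equiv.Perm.one_apply]
  have hrel : T⁻¹ * A ^ (m : ℤ) * T = A ^ ((ε : ℤ) * (m : ℤ)) := by
    rw [mul_comm, zpow_mul, hAm]
    simp
  refine ⟨lift A T hrel, by simp [hAt], by simp [hAf], fun g => ?_⟩
  induction g using induction_left with
  | one => simp
  | mul_a g ih =>
    simp only [map_mul, character_a, lift_a, one_mul, Equiv.Perm.mul_apply, hA1]
    exact ih
  | inv_a_mul g ih =>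
    simp only [map_mul, map_inv, character_a, lift_a, inv_one, one_mul, Equiv.Perm.mul_apply, hA1']
    exact ih
  | mul_t g ih =>
    have hT : ∀ p, (T p).1 = !p.1 := fun p => rfl
    simp only [map_mul, character_t, lift_t, Equiv.Perm.mul_apply, hT, hε]
    rcases ih with ⟨h1, h2⟩ | ⟨h1, h2⟩
    · exact Or.inr (by simp [h1, h2])
    · exact Or.inl (by simp [h1, h2])
  | inv_t_mul g ih =>
    have hT : ∀ p, (T⁻¹ p).1 = !p.1 := fun p => rfl
    simp only [map_mul, map_inv, character_t, lift_t, Equiv.Perm.mul_apply, hT, hε]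
    rcases ih with ⟨h1, h2⟩ | ⟨h1, h2⟩
    · exact Or.inr (by simp [h1, h2])
    · exact Or.inl (by simp [h1, h2])

theorem eq_of_intCast_zmod_eq {i j : ℤ} {N : ℕ} (hN : |i| + |j| < N)
    (h : (i : ZMod N) = j) : i = j := by
  have hdvd : (N : ℤ) ∣ i - j := by
    rw [← ZMod.intCast_zmod_eq_zero_iff_dvd]
    push_cast
    rw [h, sub_self]
  have := Int.eq_zero_of_abs_lt_dvd hdvd ((abs_sub _ _).trans_lt hN)
  omega

theorem separated_a_zpow [NeZero m] {i j : ℤ} (h : ¬IsConj (𝐚 ^ i) (𝐚 ^ j)) :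
    Separated (𝐚 ^ i) (𝐚 ^ j) := by
  obtain ⟨κ, hκ, hκc⟩ := exists_dihedral_action m ε ((|i| + |j|).toNat + 1)
  have hN : |i| + |j| < ((|i| + |j|).toNat + 1 : ℕ) := by
    have := Int.self_le_toNat (|i| + |j|)
    push_cast
    omega
  have key : ∀ g, κ (g * 𝐚 ^ i * g⁻¹) = κ (𝐚 ^ j) → (character m ε g : ℤ) * i = j := by
    intro g hg
    have h0 := Equiv.congr_fun hg 0
    rw [hκ, hκc, zero_add, zero_add] at h0
    refine eq_of_intCast_zmod_eq ?_ h0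
    rwa [abs_mul, Int.abs_eq_natAbs, Int.units_natAbs, Nat.cast_one, one_mul]
  obtain hε | hε := Int.units_eq_one_or ε
  · refine ⟨_, _, inferInstance, κ, fun g hg => h ?_⟩
    have hχ : character m ε g = 1 := by
      clear hg
      induction g using induction_left <;> simp [*]
    have := key g hg
    rw [hχ, Units.val_one, one_mul] at this
    rw [this]
  · obtain ⟨μ, hμt, hμf, hμ⟩ := exists_block_action m hε
    refine ⟨_, _, inferInstance, κ.prod μ, fun g hg => h ?_⟩
    rw [MonoidHom.prod_apply, MonoidHom.prod_apply, Prod.mk.injEq] at hg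
    have hij := key g hg.1
    obtain ⟨hχ, -⟩ | ⟨hχ, hg1⟩ := hμ g
    · rw [hχ, Units.val_one, one_mul] at hij
      rw [hij]
    · rw [hχ, Units.val_neg, Units.val_one, neg_one_mul] at hij
      have hmul : μ g * μ (𝐚 ^ i) = μ (𝐚 ^ j) * μ g := by
        rw [← hg.2, ← map_mul, ← map_mul, inv_mul_cancel_right]
      have h0 := Equiv.congr_fun hmul (true, 0)
      rw [Equiv.Perm.mul_apply, Equiv.Perm.mul_apply, hμt] at h0
      obtain ⟨⟨b, x⟩, hp⟩ : ∃ p, μ g (true, 0) = p := ⟨_, rfl⟩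
      have hb : b = false := by simpa [hp] using hg1 (true, 0)
      rw [hp, hb, hμf, Prod.mk.injEq, left_eq_add, ZMod.intCast_zmod_eq_zero_iff_dvd] at h0
      obtain ⟨c, hc⟩ := h0.2
      refine isConj_iff.mpr ⟨𝐭, ?_⟩
      have hi : i = m * -c := by rw [mul_neg, ← hc]; omega
      have ht := t_power_inv_t (m := m) (ε := ε)
      rw [power] at ht
      rw [hc, hi, zpow_mul, ← conj_zpow, ht, ← zpow_mul, ← zpow_mul, hε, Units.val_neg,
        Units.val_one]
      ring_nf

/-- The translation action of `E` on functions with values in `ℤ/2` on an `E`-set. -/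
def translate {E X : Type} [Group E] [MulAction E X] : E →* Equiv.Perm (X → ZMod 2) where
  toFun e := ⟨fun v x => v (e⁻¹ • x), fun v x => v (e • x), fun v => by simp, fun v => by simp⟩
  map_one' := by
    ext v x
    simp
  map_mul' e f := by
    ext v x
    simp [mul_smul]

section Translate

variable {E X : Type} [Group E] [MulAction E X]

theorem translate_apply (e : E) (v : X → ZMod 2) (x : X) : translate e v x = v (e⁻¹ • x) := rfl

theorem translate_add (e : E) (v w : X → ZMod 2) :
    translate e (v + w) = translate e v + translate e w := rfl

theorem translate_zero (e : E) : translate e (0 : X → ZMod 2) = 0 := rfl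

theorem translate_mul_apply (e f : E) (v : X → ZMod 2) :
    translate (e * f) v = translate e (translate f v) := by
  rw [map_mul, Equiv.Perm.mul_apply]

/-- The characteristic function of a point. -/
noncomputable def point (x : X) : X → ZMod 2 := Set.indicator {x} 1

theorem point_self (x : X) : point x x = 1 := by simp [point]

theorem point_of_ne {x y : X} (h : y ≠ x) : point x y = 0 := by simp [point, h]

theorem translate_point (e : E) (x : X) : translate e (point x) = point (e • x) := by
  ext y
  rw [translate_apply]
  by_cases h : y = e • x
  · rw [h, inv_smul_smul, point_self, point_self]
  · rw [point_of_ne h, point_of_ne]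
    rwa [Ne, inv_smul_eq_iff]

end Translate

section Chains

variable {E : Type} [Group E] (π : 𝐆 →* E)

/-- The edges of the quotient of the Bass–Serre tree by the kernel of `π`. -/
abbrev Edges : Type := E ⧸ Subgroup.zpowers (π (power m ε))

/-- The edge that is the image of the edge `g • e₀` of the Bass–Serre tree. -/
def edge (g : 𝐆) : Edges π := (π g : E ⧸ Subgroup.zpowers (π (power m ε)))

theorem smul_edge (g h : 𝐆) : π g • edge π h = edge π (g * h) := by
  rw [edge, edge, map_mul]
  rfl

theorem edge_eq_iff {g h : 𝐆} : edge π g = edge π h ↔ ∃ j : ℤ, π g * π (power m ε) ^ j = π h := by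
  rw [edge, edge, QuotientGroup.eq, Subgroup.mem_zpowers_iff]
  simp only [eq_inv_mul_iff_mul_eq]

theorem translate_power_edge_one :
    translate (π (power m ε)) (point (edge π 1)) = point (edge π 1) := by
  rw [translate_point, smul_edge, mul_one]
  congr 1
  exact (edge_eq_iff π).mpr ⟨-1, by simp⟩

/-- The affine action of `BS(m,εm)` on the `ℤ/2`-chains whose linear part is the translation action
and whose cocycle assigns to `g` the image of the geodesic from the base vertex to its translate by
`g`. -/
noncomputable def chainHom : 𝐆 →* Equiv.Perm (Edges π → ZMod 2) :=
  lift (translate (π 𝐚)) (Equiv.addLeft (point (edge π 1)) * translate (π 𝐭)) (by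
    ext1 v
    rw [← map_zpow, ← map_zpow, ← map_zpow, ← map_zpow, ← relation, ← power, mul_inv_rev, map_mul,
      map_mul, map_mul, map_mul]
    have h := translate_power_edge_one π
    simp only [Equiv.Perm.mul_apply, Equiv.coe_addLeft, map_inv, translate_add, h]
    congr 1
    exact neg_add_cancel_left _ _)

/-- The image in the `ℤ/2`-chains of the geodesic from the base vertex to its translate by `g`. -/
noncomputable def chain (g : 𝐆) : Edges π → ZMod 2 := chainHom π g 0

theorem chainHom_a (v : Edges π → ZMod 2) : chainHom π 𝐚 v = translate (π 𝐚) v := by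
  rw [chainHom, lift_a]

theorem chainHom_t (v : Edges π → ZMod 2) :
    chainHom π 𝐭 v = point (edge π 1) + translate (π 𝐭) v := by
  rw [chainHom, lift_t]
  rfl

theorem chainHom_inv_a (v : Edges π → ZMod 2) : chainHom π 𝐚⁻¹ v = translate (π 𝐚⁻¹) v := by
  rw [map_inv, Equiv.Perm.inv_eq_iff_eq, chainHom_a, ← translate_mul_apply]
  simp

theorem chainHom_inv_t (v : Edges π → ZMod 2) :
    chainHom π 𝐭⁻¹ v = point (edge π 𝐭⁻¹) + translate (π 𝐭⁻¹) v := by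
  rw [map_inv, Equiv.Perm.inv_eq_iff_eq, chainHom_t, translate_add, translate_point, smul_edge,
    ← translate_mul_apply, mul_inv_cancel, ← add_assoc, CharTwo.add_self_eq_zero]
  simp

theorem chainHom_apply (g : 𝐆) (v : Edges π → ZMod 2) :
    chainHom π g v = chain π g + translate (π g) v := by
  induction g using induction_left generalizing v with
  | one => simp [chain]
  | mul_a g ih =>
    rw [chain, map_mul, map_mul, Equiv.Perm.mul_apply, Equiv.Perm.mul_apply, chainHom_a, chainHom_a,
      translate_mul_apply, ← translate_add, ih, chain]
  | inv_a_mul g ih =>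
    rw [chain, map_mul, map_mul, Equiv.Perm.mul_apply, Equiv.Perm.mul_apply, chainHom_inv_a,
      chainHom_inv_a, translate_mul_apply, ← translate_add, ih, chain]
  | mul_t g ih =>
    rw [chain, map_mul, map_mul, Equiv.Perm.mul_apply, Equiv.Perm.mul_apply, chainHom_t, chainHom_t,
      translate_mul_apply, add_assoc, ← translate_add, ih, chain]
  | inv_t_mul g ih =>
    rw [chain, map_mul, map_mul, Equiv.Perm.mul_apply, Equiv.Perm.mul_apply, chainHom_inv_t,
      chainHom_inv_t, translate_mul_apply, add_assoc, ← translate_add, ih, chain]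

theorem chain_mul (g h : 𝐆) : chain π (g * h) = chain π g + translate (π g) (chain π h) := by
  rw [chain, map_mul, Equiv.Perm.mul_apply, chainHom_apply, ← chain]

theorem chain_one : chain π 1 = 0 := by simp [chain]

theorem chain_a_zpow (i : ℤ) : chain π (𝐚 ^ i) = 0 := by
  rw [chain, map_zpow]
  exact Equiv.Perm.zpow_apply_eq_self_of_apply_eq_self (chainHom_a π 0) i

theorem chain_t : chain π 𝐭 = point (edge π 1) := by
  rw [chain, chainHom_t, translate_zero, add_zero]

theorem chain_inv_t : chain π 𝐭⁻¹ = point (edge π 𝐭⁻¹) := by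
  rw [chain, chainHom_inv_t, translate_zero, add_zero]

theorem exists_support (g : 𝐆) : ∃ W : Set 𝐆, W.Finite ∧
    ∀ (E : Type) [Group E] (π : 𝐆 →* E) (x : Edges π), chain π g x ≠ 0 → ∃ w ∈ W, x = edge π w := by
  have hmul : ∀ s g : 𝐆, ∀ b : Set 𝐆, b.Finite → (∀ (E : Type) [Group E] (π : 𝐆 →* E)
      (x : Edges π), chain π s x ≠ 0 → ∃ w ∈ b, x = edge π w) →
      (∃ W : Set 𝐆, W.Finite ∧ ∀ (E : Type) [Group E] (π : 𝐆 →* E) (x : Edges π),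
        chain π g x ≠ 0 → ∃ w ∈ W, x = edge π w) →
      ∃ W : Set 𝐆, W.Finite ∧ ∀ (E : Type) [Group E] (π : 𝐆 →* E) (x : Edges π),
        chain π (s * g) x ≠ 0 → ∃ w ∈ W, x = edge π w := by
    rintro s g b hb hs ⟨W, hW, hg⟩
    refine ⟨b ∪ (s * ·) '' W, hb.union (hW.image _), fun E _ π x hx => ?_⟩
    rw [chain_mul, Pi.add_apply, translate_apply] at hx
    by_cases h : chain π s x = 0
    · rw [h, zero_add] at hx
      obtain ⟨w, hw, hxw⟩ := hg E π _ hx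
      refine ⟨s * w, Or.inr ⟨w, hw, rfl⟩, ?_⟩
      rw [← smul_edge, ← hxw, smul_inv_smul]
    · obtain ⟨w, hw, hxw⟩ := hs E π x h
      exact ⟨w, Or.inl hw, hxw⟩
  have hpoint : ∀ s w : 𝐆, (∀ (E : Type) [Group E] (π : 𝐆 →* E), chain π s = point (edge π w)) →
      ∀ (E : Type) [Group E] (π : 𝐆 →* E) (x : Edges π), chain π s x ≠ 0 →
        ∃ w' ∈ ({w} : Set 𝐆), x = edge π w' := by
    intro s w hs E _ π x hx
    refine ⟨w, rfl, ?_⟩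
    by_contra hne
    exact hx (by rw [hs, point_of_ne hne])
  have ha : ∀ i : ℤ, ∀ (E : Type) [Group E] (π : 𝐆 →* E) (x : Edges π), chain π (𝐚 ^ i) x ≠ 0 →
      ∃ w ∈ (∅ : Set 𝐆), x = edge π w := by
    intro i E _ π x hx
    rw [chain_a_zpow] at hx
    exact absurd rfl hx
  induction g using induction_left with
  | one => exact ⟨∅, Set.finite_empty, by simpa using ha 0⟩
  | mul_a g ih => exact hmul _ _ ∅ Set.finite_empty (by simpa using ha 1) ih
  | inv_a_mul g ih => exact hmul _ _ ∅ Set.finite_empty (by simpa using ha (-1)) ih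
  | mul_t g ih => exact hmul _ _ _ (Set.finite_singleton _) (hpoint _ _ fun _ _ => chain_t) ih
  | inv_t_mul g ih =>
    exact hmul _ _ _ (Set.finite_singleton _) (hpoint _ _ fun _ _ => chain_inv_t) ih

end Chains

section Words

variable (m ε) in
/-- The element `t^{±1}aⁱ`, the sign being given by the Boolean. -/
def letter (x : Bool × ℤ) : 𝐆 := (if x.1 then 𝐭 else 𝐭⁻¹) * 𝐚 ^ x.2

variable (m ε) in
/-- The product of the first `k` letters of an infinite word. -/
def word (f : ℕ → Bool × ℤ) : ℕ → 𝐆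
  | 0 => 1
  | k + 1 => word f k * letter m ε (f k)

theorem word_zero (f : ℕ → Bool × ℤ) : word m ε f 0 = 1 := rfl

theorem word_succ (f : ℕ → Bool × ℤ) (k : ℕ) :
    word m ε f (k + 1) = word m ε f k * letter m ε (f k) := rfl

theorem word_add (f : ℕ → Bool × ℤ) (q k : ℕ) :
    word m ε f (q + k) = word m ε f q * word m ε (fun r => f (q + r)) k := by
  induction k with
  | zero => simp [word_zero]
  | succ k ih => rw [← add_assoc, word_succ, word_succ, ih, mul_assoc]

theorem word_congr {f g : ℕ → Bool × ℤ} {k : ℕ} (h : ∀ r < k, f r = g r) :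
    word m ε f k = word m ε g k := by
  induction k with
  | zero => rfl
  | succ k ih => rw [word_succ, word_succ, ih fun r hr => h r (by omega), h k (by omega)]

theorem letter_mul_a_zpow (x : Bool × ℤ) (j : ℤ) :
    letter m ε x * 𝐚 ^ j = letter m ε (x.1, x.2 + j) := by
  rw [letter, letter, mul_assoc, ← zpow_add]

theorem exists_letter_mul_letter {x y : Bool × ℤ} (h : x.1 ≠ y.1) (hx : (m : ℤ) ∣ x.2) :
    ∃ j : ℤ, letter m ε x * letter m ε y = 𝐚 ^ j := by
  obtain ⟨c, hc⟩ := hx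
  have h1 := congrArg (· ^ c) (t_power_inv_t (m := m) (ε := ε))
  have h2 := congrArg (· ^ c) (inv_t_power_t (m := m) (ε := ε))
  have h3 := (conj_zpow : (𝐭⁻¹ * power m ε * 𝐭⁻¹⁻¹) ^ c = _)
  rw [inv_inv] at h3
  simp only [conj_zpow] at h1
  simp only [h3] at h2
  rw [← zpow_mul, power, ← zpow_mul, ← zpow_mul] at h1 h2
  refine ⟨m * (ε * c) + y.2, ?_⟩
  rw [zpow_add, letter, letter, hc]
  obtain ⟨_ | _, i⟩ := x <;> obtain ⟨_ | _, j⟩ := y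
  · exact absurd rfl h
  · rw [← h2]
    simp [mul_assoc]
  · rw [← h1]
    simp [mul_assoc]
  · exact absurd rfl h

variable (m ε) in
/-- The product of the letters of a cyclic word, read from `0`. -/
def cyclicWord {ℓ : ℕ} (w : ZMod ℓ → Bool × ℤ) : 𝐆 := word m ε (fun r => w (r : ZMod ℓ)) ℓ

variable (m) in
/-- A cyclic word is reduced if it contains no cyclic subword `t^{±1}a^{mc}t^{∓1}`. -/
def IsCyclicallyReduced {ℓ : ℕ} (w : ZMod ℓ → Bool × ℤ) : Prop :=
  ∀ q, (w q).1 = (w (q + 1)).1 ∨ ¬(m : ℤ) ∣ (w q).2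

variable (m ε) in
/-- Powers of `a` and products of cyclically reduced words. -/
def representatives : Set 𝐆 :=
  {x | (∃ i : ℤ, x = 𝐚 ^ i) ∨
    ∃ (ℓ : ℕ) (_ : NeZero ℓ) (w : ZMod ℓ → Bool × ℤ), IsCyclicallyReduced m w ∧ x = cyclicWord m ε w}

theorem exists_eq_a_zpow_mul_word (x : 𝐆) :
    ∃ (j : ℤ) (k : ℕ) (f : ℕ → Bool × ℤ), x = 𝐚 ^ j * word m ε f k := by
  have hcons : ∀ (b : Bool) (j : ℤ) (k : ℕ) (f : ℕ → Bool × ℤ),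
      (if b then 𝐭 else 𝐭⁻¹) * (𝐚 ^ j * word m ε f k) =
        𝐚 ^ (0 : ℤ) * word m ε (fun r => Nat.casesOn r (b, j) f) (k + 1) := by
    intro b j k f
    rw [add_comm k, word_add, word_succ, word_zero, zpow_zero, one_mul, one_mul, letter, ← mul_assoc]
    congr 1
    refine word_congr fun r _ => ?_
    rw [add_comm]
  induction x using induction_left with
  | one => exact ⟨0, 0, fun _ => (true, 0), by simp [word_zero]⟩
  | mul_a x ih =>
    obtain ⟨j, k, f, rfl⟩ := ih
    exact ⟨1 + j, k, f, by rw [zpow_add, zpow_one, mul_assoc]⟩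
  | inv_a_mul x ih =>
    obtain ⟨j, k, f, rfl⟩ := ih
    exact ⟨-1 + j, k, f, by rw [zpow_add, zpow_neg_one, mul_assoc]⟩
  | mul_t x ih =>
    obtain ⟨j, k, f, rfl⟩ := ih
    exact ⟨0, _, _, hcons true j k f⟩
  | inv_t_mul x ih =>
    obtain ⟨j, k, f, rfl⟩ := ih
    exact ⟨0, _, _, hcons false j k f⟩

theorem isConj_mul_comm {G : Type*} [Group G] (x y : G) : IsConj (x * y) (y * x) :=
  isConj_iff.mpr ⟨y, by group⟩

theorem isConj_cyclicWord_rotate {ℓ : ℕ} [NeZero ℓ] (w : ZMod ℓ → Bool × ℤ) (q : ZMod ℓ) :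
    IsConj (cyclicWord m ε w) (cyclicWord m ε fun r => w (q + r)) := by
  have h1 := word_add (m := m) (ε := ε) (fun r => w (r : ZMod ℓ)) ℓ q.val
  have h2 := word_add (m := m) (ε := ε) (fun r => w (r : ZMod ℓ)) q.val ℓ
  rw [add_comm, h2] at h1
  simp only [Nat.cast_add, ZMod.natCast_self, zero_add, ZMod.natCast_zmod_val] at h1
  refine isConj_iff.mpr ⟨(word m ε (fun r => w (r : ZMod ℓ)) q.val)⁻¹, ?_⟩
  rw [inv_inv, cyclicWord, mul_assoc, ← h1, inv_mul_cancel_left]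
  rfl

theorem exists_representative (x : 𝐆) : ∃ r ∈ representatives m ε, IsConj x r := by
  obtain ⟨j, k, f, rfl⟩ := exists_eq_a_zpow_mul_word x
  induction k using Nat.strong_induction_on generalizing j f with
  | _ k ih =>
    obtain _ | k := k
    · exact ⟨_, Or.inl ⟨j, by rw [word_zero, mul_one]⟩, IsConj.refl _⟩
    let w : ZMod (k + 1) → Bool × ℤ := fun q =>
      if q.val = k then ((f k).1, (f k).2 + j) else f q.val
    have hw : ∀ r < k + 1, w (r : ZMod (k + 1)) =
        if r = k then ((f k).1, (f k).2 + j) else f r := by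
      intro r hr
      simp only [w, ZMod.val_natCast_of_lt hr]
    have hconj : IsConj (𝐚 ^ j * word m ε f (k + 1)) (cyclicWord m ε w) := by
      have := isConj_mul_comm (𝐚 ^ j) (word m ε f (k + 1))
      rw [word_succ, mul_assoc _ _ (𝐚 ^ j), letter_mul_a_zpow, ← word_succ] at this
      convert this using 1
      rw [cyclicWord, word_succ, hw k (by omega), if_pos rfl]
      congr 1
      exact word_congr fun r hr => by rw [hw r (by omega), if_neg (by omega)]
    by_cases hred : IsCyclicallyReduced m w
    · exact ⟨_, Or.inr ⟨k + 1, inferInstance, w, hred, rfl⟩, hconj⟩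
    rw [IsCyclicallyReduced] at hred
    push Not at hred
    obtain ⟨q, hq, hdvd⟩ := hred
    obtain _ | k := k
    · have : Subsingleton (ZMod (0 + 1)) := inferInstanceAs (Subsingleton (Fin 1))
      exact absurd (by rw [Subsingleton.elim (q + 1) q]) hq
    obtain ⟨i, hi⟩ := exists_letter_mul_letter (ε := ε) hq hdvd
    obtain ⟨r, hr, h⟩ := ih k (by omega) i fun r => w (q + (2 + r : ℕ))
    refine ⟨r, hr, (hconj.trans (isConj_cyclicWord_rotate w q)).trans ?_⟩
    convert h using 1
    have hword := word_add (m := m) (ε := ε) (fun r => w (q + (r : ZMod (k + 1 + 1)))) 2 k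
    rw [add_comm 2 k] at hword
    rw [cyclicWord, hword, word_succ, word_succ, word_zero,
      one_mul, ← hi]
    simp

end Words

section Counting

variable {X : Type}

/-- The number, modulo two, of points of `O` at which `v` does not vanish. -/
noncomputable def parityOn (O : Set X) (v : X → ZMod 2) : ZMod 2 := ∑ᶠ x ∈ O, v x

theorem parityOn_add [Finite X] (O : Set X) (v w : X → ZMod 2) :
    parityOn O (v + w) = parityOn O v + parityOn O w :=
  finsum_mem_add_distrib O.toFinite

theorem parityOn_point_of_mem {O : Set X} {x : X} (hx : x ∈ O) : parityOn O (point x) = 1 := by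
  rw [parityOn, finsum_mem_inter_support_eq _ _ {x}, finsum_mem_singleton, point_self]
  ext y
  by_cases h : y = x
  · simp [h, hx]
  · simp [h, point_of_ne h]

theorem parityOn_point_of_notMem {O : Set X} {x : X} (hx : x ∉ O) : parityOn O (point x) = 0 :=
  finsum_mem_eq_zero_of_forall_eq_zero fun _ hy => point_of_ne fun h => hx (h ▸ hy)

theorem parityOn_translate {E : Type} [Group E] [MulAction E X] {O : Set X} {e : E}
    (he : ∀ x, e • x ∈ O ↔ x ∈ O) (v : X → ZMod 2) :
    parityOn O (translate e v) = parityOn O v := by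
  refine (finsum_mem_eq_of_bijOn (e • ·) ⟨fun x hx => (he x).mpr hx, ?_, ?_⟩ ?_).symm
  · exact (MulAction.injective e).injOn
  · intro x hx
    exact ⟨e⁻¹ • x, (he _).mp (by rwa [smul_inv_smul]), smul_inv_smul _ _⟩
  · intro x _
    rw [translate_apply, inv_smul_smul]

theorem exists_of_parityOn_ne_zero {O : Set X} {v : X → ZMod 2} (h : parityOn O v ≠ 0) :
    ∃ x ∈ O, v x ≠ 0 := by
  by_contra! h0
  exact h (finsum_mem_eq_zero_of_forall_eq_zero h0)

theorem exists_perm_apply_eq {ι : Type} [Finite X] {f g : ι → X} (hf : f.Injective)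
    (hg : g.Injective) : ∃ T : Equiv.Perm X, ∀ q, T (f q) = g q := by
  classical
  have := Fintype.ofFinite X
  let e : Set.range f ≃ Set.range g :=
    (Equiv.ofInjective f hf).symm.trans (Equiv.ofInjective g hg)
  refine ⟨Equiv.extendSubtype (p := (· ∈ Set.range f)) (q := (· ∈ Set.range g)) e, fun q => ?_⟩
  rw [Equiv.extendSubtype_apply_of_mem _ _ ⟨q, rfl⟩]
  have : (Equiv.ofInjective f hf).symm ⟨f q, q, rfl⟩ = q := Equiv.ofInjective_symm_apply hf q
  change ((Equiv.ofInjective g hg) ((Equiv.ofInjective f hf).symm ⟨f q, q, rfl⟩) : X) = g q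
  rw [this]
  rfl

end Counting

section Hyperbolic

variable (m ε) in
/-- The group element carrying the base edge of the Bass–Serre tree to the `q`-th edge of the path
traced out by a word. -/
def wordEdge (f : ℕ → Bool × ℤ) (q : ℕ) : 𝐆 :=
  if (f q).1 then word m ε f q else word m ε f q * 𝐭⁻¹

theorem chain_word_succ {E : Type} [Group E] (π : 𝐆 →* E) (f : ℕ → Bool × ℤ) (q : ℕ) :
    chain π (word m ε f (q + 1)) = chain π (word m ε f q) + point (edge π (wordEdge m ε f q)) := by
  rw [word_succ, letter, ← mul_assoc, chain_mul, chain_a_zpow, translate_zero, add_zero, chain_mul,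
    wordEdge]
  split_ifs
  · rw [chain_t, translate_point, smul_edge, mul_one]
  · rw [chain_inv_t, translate_point, smul_edge]

/-- A finite quotient in which the axis of a cyclically reduced word is traversed without
backtracking. -/
theorem exists_tracking_action [NeZero m] {ℓ : ℕ} [NeZero ℓ] {w : ZMod ℓ → Bool × ℤ}
    (hw : IsCyclicallyReduced m w) :
    ∃ (Ω : Type) (_ : Finite Ω) (ρ : 𝐆 →* Equiv.Perm Ω) (s : ZMod ℓ → Ω) (p : Ω),
      ρ (power m ε) = 1 ∧ s.Injective ∧ ρ (cyclicWord m ε w) p = p ∧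
        ∀ r : ℕ, (ρ (wordEdge m ε (fun r => w (r : ZMod ℓ)) r))⁻¹ p = s r := by
  let p : ZMod ℓ → ZMod ℓ × ZMod m := fun q => (q, ((w (q - 1)).2 : ZMod m))
  let s : ZMod ℓ → ZMod ℓ × ZMod m := fun q => if (w q).1 then p q else (q + 1, 0)
  let d : ZMod ℓ → ZMod ℓ × ZMod m := fun q => if (w q).1 then (q + 1, 0) else p q
  have hp : ∀ q q', p q = (q' + 1, 0) → (w q').1 = (w q).1 := by
    intro q q' h
    obtain ⟨h1, h2⟩ := Prod.mk.injEq _ _ _ _ ▸ h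
    rw [h1, add_sub_cancel_right, ZMod.intCast_zmod_eq_zero_iff_dvd] at h2
    rw [h1]
    exact (hw q').resolve_right (not_not_intro h2)
  have hpp : ∀ q q', p q = p q' → q = q' := fun q q' h => congrArg Prod.fst h
  have hs : s.Injective := by
    intro q q' h
    by_cases h1 : (w q).1 = true <;> by_cases h2 : (w q').1 = true <;>
      simp only [s, h1, h2, if_true] at h
    · exact hpp _ _ h
    · exact absurd ((hp _ _ h).trans h1) h2
    · exact absurd ((hp _ _ h.symm).trans h2) h1
    · simpa using h
  have hd : d.Injective := by
    intro q q' h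
    by_cases h1 : (w q).1 = true <;> by_cases h2 : (w q').1 = true <;>
      simp only [d, h1, h2, if_true] at h
    · simpa using h
    · exact absurd ((hp _ _ h.symm).symm.trans h1) h2
    · exact absurd ((hp _ _ h).symm.trans h2) h1
    · exact hpp _ _ h
  obtain ⟨T, hT⟩ := exists_perm_apply_eq hs hd
  let A : Equiv.Perm (ZMod ℓ × ZMod m) := Equiv.prodCongr (Equiv.refl _) (Equiv.addRight 1)
  have hA : ∀ (i : ℤ) q x, (A ^ i) (q, x) = (q, x + i) := by
    intro i
    induction i with
    | zero => simp
    | succ i ih =>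
      intro q x
      have : A (q, x) = (q, x + 1) := rfl
      rw [zpow_add_one, Equiv.Perm.mul_apply, this, ih]
      push_cast
      ring_nf
    | pred i ih =>
      intro q x
      have : A⁻¹ (q, x) = (q, x - 1) := by
        rw [Equiv.Perm.inv_eq_iff_eq]
        simp [A]
      rw [zpow_sub_one, Equiv.Perm.mul_apply, this, ih]
      push_cast
      ring_nf
  have hAm : A⁻¹ ^ (m : ℤ) = 1 := by
    ext1 ⟨q, x⟩
    rw [inv_zpow', hA]
    simp
  have hrel : T⁻¹⁻¹ * A⁻¹ ^ (m : ℤ) * T⁻¹ = A⁻¹ ^ ((ε : ℤ) * (m : ℤ)) := by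
    rw [mul_comm (ε : ℤ), zpow_mul, hAm]
    simp
  have hword : ∀ r : ℕ, (lift A⁻¹ T⁻¹ hrel (word m ε (fun r => w (r : ZMod ℓ)) r))⁻¹ (p 0) = p r := by
    intro r
    induction r with
    | zero => simp [word_zero]
    | succ r ih =>
      have hpr : p ((r + 1 : ℕ) : ZMod ℓ) = (A ^ (w r).2) ((r : ZMod ℓ) + 1, 0) := by
        rw [hA]
        simp [p]
      rw [word_succ, map_mul, mul_inv_rev, Equiv.Perm.mul_apply, ih, letter, map_mul, mul_inv_rev,
        map_zpow, lift_a, inv_zpow, inv_inv, Equiv.Perm.mul_apply, hpr]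
      congr 1
      have hTr := hT r
      simp only [s, d] at hTr
      split_ifs at hTr ⊢ with h
      · rw [lift_t, inv_inv, hTr]
      · rw [map_inv, lift_t, inv_inv, Equiv.Perm.inv_eq_iff_eq, hTr]
  refine ⟨_, inferInstance, lift A⁻¹ T⁻¹ hrel, s, p 0, ?_, hs, ?_, ?_⟩
  · rw [power, map_zpow, lift_a, hAm]
  · have := hword ℓ
    rw [Equiv.Perm.inv_eq_iff_eq, ZMod.natCast_self] at this
    exact this.symm
  · intro r
    have hTr := hT r
    simp only [s, d] at hTr
    simp only [wordEdge, s]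
    split_ifs at hTr ⊢ with h
    · exact hword r
    · rw [map_mul, mul_inv_rev, Equiv.Perm.mul_apply, hword, map_inv, lift_t, inv_inv,
        Equiv.Perm.inv_eq_iff_eq, hTr]

/-- The edges of the quotient tree on the image of the axis of `y` lying in the orbit of `u`. -/
def axisEdges {E : Type} [Group E] (π : 𝐆 →* E) (y u : 𝐆) : Set (Edges π) :=
  Set.range fun i : ℤ => edge π (y ^ i * u)

theorem smul_mem_axisEdges {E : Type} [Group E] (π : 𝐆 →* E) (y u : 𝐆) (x : Edges π) :
    π y • x ∈ axisEdges π y u ↔ x ∈ axisEdges π y u := by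
  constructor
  · rintro ⟨i, hi⟩
    refine ⟨-1 + i, ?_⟩
    rw [← (MulAction.injective (π y)).eq_iff, ← hi]
    simp only
    rw [smul_edge, ← mul_assoc, ← zpow_one_add, add_neg_cancel_left]
  · rintro ⟨i, rfl⟩
    refine ⟨1 + i, ?_⟩
    simp only
    rw [smul_edge, zpow_one_add, mul_assoc]

theorem exists_axis_parity [NeZero m] {ℓ : ℕ} [NeZero ℓ] {w : ZMod ℓ → Bool × ℤ}
    (hw : IsCyclicallyReduced m w) :
    ∃ (F : Type) (_ : Group F) (_ : Finite F) (ρ : 𝐆 →* F) (u : 𝐆), ρ (power m ε) = 1 ∧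
      ∀ (E : Type) [Group E] (π : 𝐆 →* E) [Finite E] (θ : E →* F), θ.comp π = ρ →
        parityOn (axisEdges π (cyclicWord m ε w) u) (chain π (cyclicWord m ε w)) = 1 := by
  obtain ⟨Ω, _, ρ, s, p, hz, hs, hy, hedge⟩ := exists_tracking_action (ε := ε) hw
  set f : ℕ → Bool × ℤ := fun r => w (r : ZMod ℓ) with hf
  refine ⟨_, inferInstance, inferInstance, ρ, wordEdge m ε f 0, hz, fun E _ π _ θ hθ => ?_⟩
  have hθ' : ∀ g, θ (π g) = ρ g := fun g => by rw [← hθ]; rfl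
  have hmem : ∀ r : ℕ, edge π (wordEdge m ε f r) ∈
      axisEdges π (cyclicWord m ε w) (wordEdge m ε f 0) → (r : ZMod ℓ) = 0 := by
    rintro r ⟨i, hi⟩
    obtain ⟨j, hj⟩ := (edge_eq_iff π).mp hi
    have h := congrArg θ hj
    rw [map_mul, map_zpow, hθ', hθ', hθ', hz, one_zpow, mul_one] at h
    rw [← hs.eq_iff, ← hedge r, ← h, map_mul, mul_inv_rev, Equiv.Perm.mul_apply, map_zpow,
      ← zpow_neg, Equiv.Perm.zpow_apply_eq_self_of_apply_eq_self hy, hedge 0, Nat.cast_zero]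
  have key : ∀ k < ℓ, parityOn (axisEdges π (cyclicWord m ε w) (wordEdge m ε f 0))
      (chain π (word m ε f (k + 1))) = 1 := by
    intro k hk
    induction k with
    | zero =>
      rw [chain_word_succ, word_zero, chain_one, zero_add, parityOn_point_of_mem]
      exact ⟨0, by simp⟩
    | succ k ih =>
      rw [chain_word_succ, parityOn_add, ih (by omega), parityOn_point_of_notMem, add_zero]
      intro h
      have := hmem _ h
      rw [ZMod.natCast_eq_zero_iff] at this
      exact absurd (Nat.le_of_dvd (by omega) this) (by omega)
  have hℓ : ℓ - 1 + 1 = ℓ := Nat.succ_pred_eq_of_pos (NeZero.pos ℓ)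
  have := key (ℓ - 1) (by omega)
  rwa [hℓ] at this

end Hyperbolic

section Conclusion

/-- Elements outside `⟨aᵐ⟩` survive in a finite quotient that kills `aᵐ`. -/
theorem exists_ne_one_of_notMem_zpowers [NeZero m] {g : 𝐆}
    (hg : g ∉ Subgroup.zpowers (power m ε)) :
    ∃ (F : Type) (_ : Group F) (_ : Finite F) (τ : 𝐆 →* F), τ (power m ε) = 1 ∧ τ g ≠ 1 := by
  obtain ⟨r, hr, hgr⟩ := exists_representative g
  have hτ : ∀ {F : Type} [Group F] (τ : 𝐆 →* F), τ r ≠ 1 → τ g ≠ 1 := by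
    intro F _ τ hne h
    have := τ.map_isConj hgr
    rw [h, isConj_one_right] at this
    exact hne this
  obtain ⟨i, rfl⟩ | ⟨ℓ, _, w, hw, rfl⟩ := hr
  · obtain ⟨κ, hκ, -⟩ := exists_dihedral_action m ε m
    refine ⟨_, _, inferInstance, κ, ?_, hτ κ fun h => hg ?_⟩
    · ext1 x
      rw [power, hκ]
      simp
    · have h0 := Equiv.congr_fun h 0
      rw [hκ, zero_add, Equiv.Perm.one_apply, ZMod.intCast_zmod_eq_zero_iff_dvd] at h0
      obtain ⟨c, rfl⟩ := h0
      obtain ⟨b, hb⟩ := isConj_iff.mp hgr.symm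
      rw [← hb, zpow_mul, ← power, ← conj_zpow, conj_power, ← zpow_mul]
      exact Subgroup.zpow_mem_zpowers _ _
  · obtain ⟨F, _, _, ρ, u, hz, hpar⟩ := exists_axis_parity (ε := ε) hw
    refine ⟨_, inferInstance, inferInstance, chainHom ρ, ?_, hτ _ fun h => ?_⟩
    · have htr : translate (ρ (power m ε)) = (1 : Equiv.Perm (Edges ρ → ZMod 2)) :=
        (congrArg translate hz).trans (map_one _)
      have hch : chain ρ (power m ε) = 0 := chain_a_zpow ρ m
      ext1 v
      rw [chainHom_apply, htr, hch, zero_add]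
    · have h1 := hpar F ρ (MonoidHom.id F) rfl
      rw [chain, h] at h1
      simp [parityOn] at h1

theorem exists_ne_conj_power [NeZero m] {v v' : 𝐆}
    (h : ∀ j : ℤ, v' ≠ power m ε ^ (-j) * v * power m ε ^ j) :
    ∃ (F : Type) (_ : Group F) (_ : Finite F) (τ : 𝐆 →* F),
      ∀ j : ℤ, τ v' ≠ τ (power m ε ^ (-j) * v * power m ε ^ j) := by
  by_cases hv : v⁻¹ * v' ∈ Subgroup.zpowers (power m ε)
  · obtain ⟨c, hc⟩ := Subgroup.mem_zpowers_iff.mp hv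
    obtain rfl : v' = v * power m ε ^ c := by rw [hc, mul_inv_cancel_left]
    simp only [conj_by_power, Ne, mul_right_inj, map_mul] at h ⊢
    have hdih : ∀ N : ℕ, NeZero N → (∀ j : ℤ, ((m * c : ℤ) : ZMod N) ≠
        ((m * (j - (character m ε v : ℤ) * j) : ℤ) : ZMod N)) →
        ∃ (F : Type) (_ : Group F) (_ : Finite F) (τ : 𝐆 →* F),
          ∀ j : ℤ, ¬τ (power m ε ^ c) = τ (power m ε ^ (j - (character m ε v : ℤ) * j)) := by
      intro N _ hN
      obtain ⟨κ, hκ, -⟩ := exists_dihedral_action m ε N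
      refine ⟨_, _, inferInstance, κ, fun j hj => hN j ?_⟩
      have h0 := Equiv.congr_fun hj 0
      rwa [power, ← zpow_mul, ← zpow_mul, hκ, hκ, zero_add, zero_add] at h0
    obtain hχ | hχ := Int.units_eq_one_or (character m ε v)
    · simp only [hχ, Units.val_one, one_mul, sub_self] at h hdih ⊢
      have hc0 : c ≠ 0 := by
        rintro rfl
        exact h 0 rfl
      refine hdih ((m * c).natAbs + 1) inferInstance fun _ heq => ?_
      have := eq_of_intCast_zmod_eq (by push_cast; simp) heq
      rw [mul_zero, mul_eq_zero] at this
      exact this.elim (by exact_mod_cast NeZero.ne m) hc0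
    · simp only [hχ, Units.val_neg, Units.val_one, neg_one_mul, sub_neg_eq_add] at h hdih ⊢
      refine hdih (2 * m) inferInstance fun j heq => ?_
      rw [ZMod.intCast_eq_intCast_iff_dvd_sub] at heq
      obtain ⟨d, hd⟩ := heq
      have hm : (m : ℤ) ≠ 0 := by exact_mod_cast NeZero.ne m
      have hd' : (m : ℤ) * (j + j - c) = m * (2 * d) := by
        rw [mul_sub, hd]
        push_cast
        ring
      have := mul_left_cancel₀ hm hd'
      exact h (j - d) (by congr 1; omega)
  · obtain ⟨F, _, _, τ, hz, hτ⟩ := exists_ne_one_of_notMem_zpowers hv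
    refine ⟨F, _, inferInstance, τ, fun j hj => hτ ?_⟩
    rw [map_mul, map_mul, map_zpow, map_zpow, hz, one_zpow, one_zpow, one_mul, mul_one] at hj
    rw [map_mul, map_inv, hj, inv_mul_cancel]

theorem exists_ne_conj_power_of_finite [NeZero m] {v : 𝐆} {W : Set 𝐆} (hW : W.Finite)
    (h : ∀ v' ∈ W, ∀ j : ℤ, v' ≠ power m ε ^ (-j) * v * power m ε ^ j) :
    ∃ (F : Type) (_ : Group F) (_ : Finite F) (τ : 𝐆 →* F),
      ∀ v' ∈ W, ∀ j : ℤ, τ v' ≠ τ (power m ε ^ (-j) * v * power m ε ^ j) := by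
  induction W, hW using Set.Finite.induction_on with
  | empty => exact ⟨Unit, inferInstance, inferInstance, 1, by simp⟩
  | insert _ _ ih =>
    obtain ⟨F₁, _, _, τ₁, h₁⟩ := exists_ne_conj_power (h _ (Set.mem_insert _ _))
    obtain ⟨F₂, _, _, τ₂, h₂⟩ := ih fun v' hv' => h v' (Set.mem_insert_of_mem _ hv')
    refine ⟨F₁ × F₂, inferInstance, inferInstance, τ₁.prod τ₂, ?_⟩
    rintro v' (rfl | hv') j heq
    · exact h₁ j (congrArg Prod.fst heq)
    · exact h₂ v' hv' j (congrArg Prod.snd heq)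

theorem exists_of_conj_of_parity {E : Type} [Group E] [Finite E] {π : 𝐆 →* E} {x y u g : 𝐆}
    {W : Set 𝐆} (hW : ∀ e : Edges π, chain π x e ≠ 0 → ∃ w ∈ W, e = edge π w)
    (hy : parityOn (axisEdges π y u) (chain π y) = 1) (hπ : π (g * x * g⁻¹) = π y)
    (hchain : chain π (g * x * g⁻¹) = chain π y) :
    ∃ w ∈ W, ∃ j : ℤ, π (w⁻¹ * x * w) = π (power m ε ^ (-j) * (u⁻¹ * y * u) * power m ε ^ j) := by
  have hcocycle : translate (π g) (chain π x) =
      chain π y + (translate (π y) (chain π g) + chain π g) := by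
    have h1 : chain π (g * x) = chain π y + translate (π y) (chain π g) := by
      rw [← hchain, ← hπ, ← chain_mul, inv_mul_cancel_right]
    rw [chain_mul] at h1
    rw [← add_assoc, ← h1, add_right_comm, CharTwo.add_self_eq_zero, zero_add]
  have hpar : parityOn (axisEdges π y u) (translate (π g) (chain π x)) = 1 := by
    rw [hcocycle, parityOn_add, parityOn_add, parityOn_translate (smul_mem_axisEdges π y u), hy,
      CharTwo.add_self_eq_zero, add_zero]
  obtain ⟨e, ⟨i, rfl⟩, he⟩ := exists_of_parityOn_ne_zero (hpar ▸ one_ne_zero)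
  rw [translate_apply] at he
  obtain ⟨w, hw, hew⟩ := hW _ he
  rw [inv_smul_eq_iff, smul_edge, edge_eq_iff] at hew
  obtain ⟨j, hj⟩ := hew
  refine ⟨w, hw, j, ?_⟩
  have h1 : π (w⁻¹ * x * w) = (π (g * w))⁻¹ * π (g * x * g⁻¹) * π (g * w) := by
    rw [← map_inv, ← map_mul, ← map_mul]
    congr 1
    group
  rw [h1, ← hj, hπ, ← map_zpow, ← map_mul, ← map_inv, ← map_mul, ← map_mul]
  congr 1
  group

theorem separated_cyclicWord [NeZero m] {ℓ : ℕ} [NeZero ℓ] {w : ZMod ℓ → Bool × ℤ}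
    (hw : IsCyclicallyReduced m w) {x : 𝐆} (h : ¬IsConj x (cyclicWord m ε w)) :
    Separated x (cyclicWord m ε w) := by
  obtain ⟨F, _, _, ρ, u, -, hpar⟩ := exists_axis_parity (ε := ε) hw
  obtain ⟨W, hW, hsupp⟩ := exists_support x
  obtain ⟨F', _, _, τ, hτ⟩ := exists_ne_conj_power_of_finite (v := u⁻¹ * cyclicWord m ε w * u)
    (hW.image fun v => v⁻¹ * x * v) (by
      rintro _ ⟨v, -, rfl⟩ j heq
      refine h (isConj_iff.mpr ⟨u * power m ε ^ j * v⁻¹, ?_⟩)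
      calc u * power m ε ^ j * v⁻¹ * x * (u * power m ε ^ j * v⁻¹)⁻¹
          = u * power m ε ^ j * (v⁻¹ * x * v) * (u * power m ε ^ j)⁻¹ := by group
        _ = cyclicWord m ε w := by
          simp only at heq
          rw [heq]
          group)
  let π : 𝐆 →* F × F' := ρ.prod τ
  refine ⟨(F × F') × Equiv.Perm (Edges π → ZMod 2), inferInstance, inferInstance,
    π.prod (chainHom π), fun g hg => ?_⟩
  rw [MonoidHom.prod_apply, MonoidHom.prod_apply, Prod.mk.injEq] at hg
  obtain ⟨v, hv, j, heq⟩ := exists_of_conj_of_parity (hsupp _ π)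
    (hpar _ π (MonoidHom.fst F F') rfl) hg.1 (Equiv.congr_fun hg.2 0)
  exact hτ _ ⟨v, hv, rfl⟩ j (congrArg Prod.snd heq)

theorem conjugacySeparable_unimodular [NeZero m] : ConjugacySeparable 𝐆 := by
  refine conjugacySeparable_of_representatives (representatives m ε) exists_representative ?_
  rintro x hx y (⟨j, rfl⟩ | ⟨ℓ, _, w, hw, rfl⟩) h
  · obtain ⟨i, rfl⟩ | ⟨ℓ, _, w, hw, rfl⟩ := hx
    · exact separated_a_zpow h
    · exact (separated_cyclicWord hw fun h' => h h'.symm).symm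
  · exact separated_cyclicWord hw h

end Conclusion

end Unimodular

end BaumslagSolitar

/-- if `BS(m,n)` with `0 < m ≤ |n|` is residually finite, then it is conjugacy
separable. -/
theorem stmt10 (m n : ℤ) (hm : 0 < m) (hmn : m ≤ |n|)
    (h : ResiduallyFinite (BS m n)) : ConjugacySeparable (BS m n) := by
  by_cases hn : |n| = m
  · lift m to ℕ using hm.le
    have : NeZero m := ⟨by omega⟩
    obtain ⟨ε, rfl⟩ : ∃ ε : ℤˣ, n = (ε : ℤ) * (m : ℤ) := by
      rcases abs_eq hm.le |>.mp hn with rfl | rfl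
      · exact ⟨1, by simp⟩
      · exact ⟨-1, by simp⟩
    exact BaumslagSolitar.conjugacySeparable_unimodular
  · obtain rfl | h' := BaumslagSolitar.eq_one_or_abs_eq_of_residuallyFinite hm hmn h
    · exact BaumslagSolitar.conjugacySeparable_one (by omega)
    · exact absurd h' hn
end

section
/- Let 𝒞 be a root class of groups consisting only of periodic groups and let n ∈ ℤ∖{0}. The group BS(1,n) is conjugacy 𝒞-separable if and only if for all u,v,w ∈ ℤ with t^u·a^v and t^u·a^w not conjugate in BS(1,n), there exists a pair (r,s) ∈ Ω(n,𝔓(𝒞)) such that the images of t^u·a^v and t^u·a^w under the natural projection η : BS(1,n) → H(n,r,s) are not conjugate in H(n,r,s). -/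
theorem BS_relation (n : ℤ) : BSa 1 n * BSt 1 n = BSt 1 n * BSa 1 n ^ n := by
  have h : (BSt 1 n)⁻¹ * BSa 1 n ^ (1 : ℤ) * BSt 1 n * BSa 1 n ^ (-n) = 1 :=
    PresentedGroup.one_of_mem (rels := BSrels 1 n) rfl
  rw [zpow_one, zpow_neg, mul_inv_eq_one, mul_assoc, inv_mul_eq_iff_eq_mul] at h
  exact h

theorem BS_exists_hom {n : ℤ} {G : Type*} [Group G] {a t : G} (h : a * t = t * a ^ n) :
    ∃ f : BS 1 n →* G, f (BSa 1 n) = a ∧ f (BSt 1 n) = t := by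
  have hrel : ∀ x ∈ BSrels 1 n, FreeGroup.lift (fun b : Bool => if b then t else a) x = 1 := by
    rintro x rfl
    simp [mul_assoc t⁻¹ a t, h]
  exact ⟨PresentedGroup.toGroup hrel, (PresentedGroup.toGroup.of hrel).trans (by simp),
    (PresentedGroup.toGroup.of hrel).trans (by simp)⟩

theorem BS_closure_generators (n : ℤ) :
    Subgroup.closure {BSa 1 n, BSt 1 n} = (⊤ : Subgroup (BS 1 n)) := by
  rw [← top_le_iff]
  refine (PresentedGroup.closure_range_of (BSrels 1 n)).ge.trans (Subgroup.closure_mono ?_)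
  rintro _ ⟨b, rfl⟩
  cases b
  · exact Or.inl rfl
  · exact Or.inr rfl

theorem zpow_mul_pow_of_relation {G : Type*} [Group G] {n : ℤ} {a t : G}
    (h : a * t = t * a ^ n) (v : ℤ) (j : ℕ) : a ^ v * t ^ j = t ^ j * a ^ (v * n ^ j) := by
  have hconj : ∀ v : ℤ, a ^ v * t = t * a ^ (v * n) := fun v => by
    have : SemiconjBy t (a ^ n) a := h.symm
    rw [mul_comm, zpow_mul]
    exact (this.zpow_right v).symm
  induction j generalizing v with
  | zero => simp
  | succ j ih =>
    rw [pow_succ, ← mul_assoc, ih, mul_assoc, hconj, ← mul_assoc, pow_succ, mul_assoc v]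

theorem BS_exists_normal_form {n : ℤ} (x : BS 1 n) :
    ∃ (i v : ℤ) (j : ℕ), x = BSt 1 n ^ i * BSa 1 n ^ v * (BSt 1 n ^ j)⁻¹ := by
  have hmul : ∀ (i v k : ℤ) (j : ℕ), BSt 1 n ^ i * BSa 1 n ^ v * (BSt 1 n ^ j)⁻¹ * BSa 1 n ^ k =
      BSt 1 n ^ i * BSa 1 n ^ (v + k * n ^ j) * (BSt 1 n ^ j)⁻¹ := by
    intro i v k j
    rw [eq_mul_inv_iff_mul_eq, mul_assoc, zpow_mul_pow_of_relation (BS_relation n), zpow_add]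
    group
  have hx : x ∈ Subgroup.closure {BSa 1 n, BSt 1 n} := by simp [BS_closure_generators]
  induction hx using Subgroup.closure_induction_right with
  | one => exact ⟨0, 0, 0, by simp⟩
  | mul_right x y _ hy ih =>
    obtain ⟨i, v, j, rfl⟩ := ih
    rcases hy with rfl | rfl
    · exact ⟨i, _, j, by simpa using hmul i v 1 j⟩
    · cases j with
      | zero =>
        refine ⟨i + 1, v * n, 0, ?_⟩
        have := zpow_mul_pow_of_relation (BS_relation n) v 1
        simp only [pow_one] at this
        simp [mul_assoc, this, zpow_add]
      | succ j => exact ⟨i, v, j, by rw [pow_succ']; group⟩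
  | mul_inv_cancel x y _ hy ih =>
    obtain ⟨i, v, j, rfl⟩ := ih
    rcases hy with rfl | rfl
    · exact ⟨i, _, j, by simpa using hmul i v (-1) j⟩
    · exact ⟨i, v, j + 1, by rw [pow_succ']; group⟩

theorem BS_exists_isConj {n : ℤ} (x : BS 1 n) :
    ∃ u v : ℤ, IsConj x (BSt 1 n ^ u * BSa 1 n ^ v) := by
  obtain ⟨i, v, j, rfl⟩ := BS_exists_normal_form x
  refine ⟨i - j, v, isConj_iff.2 ⟨(BSt 1 n ^ j)⁻¹, ?_⟩⟩
  rw [sub_eq_neg_add, zpow_add]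
  group

theorem Hgrp_relation (n r s : ℤ) : Ha n r s * Ht n r s = Ht n r s * Ha n r s ^ n := by
  have h : (Ht n r s)⁻¹ * Ha n r s * Ht n r s * Ha n r s ^ (-n) = 1 :=
    PresentedGroup.one_of_mem (rels := Hrels n r s) (Or.inl rfl)
  rw [zpow_neg, mul_inv_eq_one, mul_assoc, inv_mul_eq_iff_eq_mul] at h
  exact h

theorem Ht_zpow (n r s : ℤ) : Ht n r s ^ r = 1 :=
  PresentedGroup.one_of_mem (rels := Hrels n r s) (Or.inr (Or.inl rfl))

theorem Ha_zpow (n r s : ℤ) : Ha n r s ^ s = 1 :=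
  PresentedGroup.one_of_mem (rels := Hrels n r s) (Or.inr (Or.inr rfl))

theorem Hgrp_exists_hom {n r s : ℤ} {G : Type*} [Group G] {a t : G} (h : a * t = t * a ^ n)
    (ht : t ^ r = 1) (ha : a ^ s = 1) :
    ∃ f : Hgrp n r s →* G, f (Ha n r s) = a ∧ f (Ht n r s) = t := by
  have hrel : ∀ x ∈ Hrels n r s, FreeGroup.lift (fun b : Bool => if b then t else a) x = 1 := by
    rintro x (rfl | rfl | rfl)
    · simp [mul_assoc t⁻¹ a t, h]
    · simp [ht]
    · simp [ha]
  exact ⟨PresentedGroup.toGroup hrel, (PresentedGroup.toGroup.of hrel).trans (by simp),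
    (PresentedGroup.toGroup.of hrel).trans (by simp)⟩

theorem Hgrp_closure_generators (n r s : ℤ) :
    Subgroup.closure {Ha n r s, Ht n r s} = (⊤ : Subgroup (Hgrp n r s)) := by
  rw [← top_le_iff]
  refine (PresentedGroup.closure_range_of (Hrels n r s)).ge.trans (Subgroup.closure_mono ?_)
  rintro _ ⟨b, rfl⟩
  cases b
  · exact Or.inl rfl
  · exact Or.inr rfl

theorem zpowers_Ha_normal {n r s : ℤ} (hr : 0 < r) : (Subgroup.zpowers (Ha n r s)).Normal := by
  rw [← Subgroup.normalizer_eq_top_iff, ← top_le_iff, ← Hgrp_closure_generators,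
    Subgroup.closure_le]
  have hfin : IsOfFinOrder (Ht n r s) :=
    isOfFinOrder_iff_zpow_eq_one.2 ⟨r, hr.ne', Ht_zpow n r s⟩
  have hinv : ∀ j : ℕ, ∀ h ∈ Subgroup.zpowers (Ha n r s),
      (Ht n r s ^ j)⁻¹ * h * Ht n r s ^ j ∈ Subgroup.zpowers (Ha n r s) := by
    rintro j _ ⟨v, rfl⟩
    exact ⟨v * n ^ j, by
      simp only [mul_assoc, zpow_mul_pow_of_relation (Hgrp_relation n r s), inv_mul_cancel_left]⟩
  rintro x (rfl | rfl)
  · exact Subgroup.le_normalizer (Subgroup.mem_zpowers _)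
  · obtain ⟨j, hj⟩ := hfin.mem_powers_iff_mem_zpowers.2
      (inv_mem (Subgroup.mem_zpowers (Ht n r s)))
    simp only at hj
    rw [SetLike.mem_coe, Subgroup.mem_normalizer_iff]
    intro h
    refine ⟨fun hh => ?_, fun hh => ?_⟩
    · simpa [hj] using hinv j h hh
    · simpa [mul_assoc] using hinv 1 _ hh

namespace IsRootClass

variable {C : GroupClass}

theorem of_subsingleton (hC : IsRootClass C) (G : Type) [Group G] [Subsingleton G] : C G := by
  obtain ⟨X, _, hX, -⟩ := hC.has_nontrivial
  have : Unique G := ⟨⟨1⟩, fun _ => Subsingleton.elim _ _⟩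
  exact hC.iso_closed _ _ MulEquiv.ofUnique (hC.subgroup_closed X ⊥ hX)

theorem of_card_prime (hC : IsRootClass C) (hper : PeriodicClass C) {p : ℕ}
    (hp : p ∈ PrimesOf C) (G : Type) [Group G] (hG : Nat.card G = p) : C G := by
  obtain ⟨hp, X, _, hX, g, hg⟩ := hp
  have : Fact p.Prime := ⟨hp⟩
  have hpos : 0 < orderOf g := (hper X hX g).orderOf_pos
  have hord : orderOf (g ^ (orderOf g / p)) = p := orderOf_pow_orderOf_div hpos.ne' hg
  have hcard : Nat.card (Subgroup.zpowers (g ^ (orderOf g / p))) = p := by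
    rw [Nat.card_zpowers, hord]
  exact hC.iso_closed _ _ (mulEquivOfPrimeCardEq hcard hG) (hC.subgroup_closed X _ hX)

theorem of_isCyclic (hC : IsRootClass C) (hper : PeriodicClass C) (G : Type) [Group G]
    [Finite G] [IsCyclic G] (hG : IsPNat (PrimesOf C) (Nat.card G)) : C G := by
  induction hm : Nat.card G using Nat.strong_induction_on generalizing G with
  | _ m ih =>
    by_cases h1 : m = 1
    · have : Subsingleton G := (Nat.card_eq_one_iff_unique.1 (hm.trans h1)).1
      exact hC.of_subsingleton G
    · obtain ⟨p, hp, hpm⟩ := Nat.exists_prime_and_dvd h1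
      have : Fact p.Prime := ⟨hp⟩
      obtain ⟨g, hg⟩ := exists_prime_orderOf_dvd_card' (G := G) p (hm ▸ hpm)
      let _ : CommGroup G := IsCyclic.commGroup
      have hcard : Nat.card (Subgroup.zpowers g) = p := by rw [Nat.card_zpowers, hg]
      have hmul := Subgroup.card_eq_card_quotient_mul_card_subgroup (Subgroup.zpowers g)
      have hcyc : IsCyclic (G ⧸ Subgroup.zpowers g) :=
        isCyclic_of_surjective (QuotientGroup.mk' (Subgroup.zpowers g))
          (QuotientGroup.mk'_surjective _)
      refine hC.extension_closed G (Subgroup.zpowers g)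
        (hC.of_card_prime hper (hG p hp (hm ▸ hpm)) _ hcard) ?_
      refine ih _ ?_ (G ⧸ Subgroup.zpowers g)
        (fun q hq hqd => hG q hq (hqd.trans ⟨_, hmul⟩)) rfl
      rw [← hm, hmul, hcard]
      exact lt_mul_of_one_lt_right Nat.card_pos hp.one_lt

theorem of_generator (hC : IsRootClass C) (hper : PeriodicClass C) {G : Type} [Group G] {g : G}
    (hg : ∀ x, x ∈ Subgroup.zpowers g) {k : ℤ} (hk : k ≠ 0) (hP : IsPInt (PrimesOf C) k)
    (hgk : g ^ k = 1) : C G := by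
  have hfin : IsOfFinOrder g := isOfFinOrder_iff_zpow_eq_one.2 ⟨k, hk, hgk⟩
  have hcard : Nat.card G = orderOf g := (orderOf_eq_card_of_forall_mem_zpowers hg).symm
  have : Finite G := Nat.finite_of_card_ne_zero (hcard ▸ hfin.orderOf_pos.ne')
  have : IsCyclic G := ⟨g, hg⟩
  refine hC.of_isCyclic hper G fun p hp hpd => hP p hp ?_
  exact (Int.natCast_dvd_natCast.2 (hcard ▸ hpd)).trans (orderOf_dvd_iff_zpow_eq_one.2 hgk)

theorem Hgrp_mem (hC : IsRootClass C) (hper : PeriodicClass C) {n r s : ℤ}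
    (h : (r, s) ∈ OmegaP n (PrimesOf C)) : C (Hgrp n r s) := by
  obtain ⟨hr, hs, hPr, hPs, -⟩ := h
  simp only at hr hs hPr hPs
  have := zpowers_Ha_normal (n := n) (s := s) hr
  refine hC.extension_closed _ (Subgroup.zpowers (Ha n r s)) ?_ ?_
  · refine hC.of_generator hper (g := ⟨Ha n r s, Subgroup.mem_zpowers _⟩) ?_ hs.ne' hPs
      (Subtype.ext (Ha_zpow n r s))
    rintro ⟨_, v, rfl⟩
    exact ⟨v, rfl⟩
  · refine hC.of_generator hper (g := (QuotientGroup.mk' _ (Ht n r s))) ?_ hr.ne' hPr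
      (by rw [← map_zpow, Ht_zpow, map_one])
    intro x
    obtain ⟨x, rfl⟩ := QuotientGroup.mk'_surjective _ x
    rw [← Subgroup.mem_comap]
    have hle : Subgroup.closure {Ha n r s, Ht n r s} ≤ (Subgroup.zpowers
        (QuotientGroup.mk' (Subgroup.zpowers (Ha n r s)) (Ht n r s))).comap
        (QuotientGroup.mk' (Subgroup.zpowers (Ha n r s))) := by
      rw [Subgroup.closure_le]
      rintro y (rfl | rfl)
      · have hker : QuotientGroup.mk' (Subgroup.zpowers (Ha n r s)) (Ha n r s) = 1 :=
          (QuotientGroup.eq_one_iff _).2 (Subgroup.mem_zpowers _)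
        rw [SetLike.mem_coe, Subgroup.mem_comap, hker]
        exact one_mem _
      · exact Subgroup.mem_zpowers _
    exact hle (by simp [Hgrp_closure_generators])

theorem exists_surjective_of_hom (hC : IsRootClass C) {X G : Type} [Group X] [Group G] (hG : C G)
    (f : X →* G) {x y : X} (h : ¬ IsConj (f x) (f y)) :
    ∃ (K : Type) (_ : Group K), C K ∧
      ∃ σ : X →* K, Function.Surjective σ ∧ ¬ IsConj (σ x) (σ y) :=
  ⟨f.range, inferInstance, hC.subgroup_closed G _ hG, f.rangeRestrict,
    f.rangeRestrict_surjective, fun hc => h (f.range.subtype.map_isConj hc)⟩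

theorem primesOf_nonempty (hC : IsRootClass C) : (PrimesOf C).Nonempty := by
  obtain ⟨X, _, hX, _⟩ := hC.has_nontrivial
  obtain ⟨g, hg⟩ := exists_ne (1 : X)
  obtain ⟨p, hp, hpd⟩ := Nat.exists_prime_and_dvd (mt orderOf_eq_one_iff.1 hg)
  exact ⟨p, hp, X, _, hX, g, hpd⟩

theorem exists_hom_BS_of_ne (hC : IsRootClass C) (hper : PeriodicClass C) (n : ℤ) {u u' : ℤ}
    (hu : u ≠ u') : ∃ (G : Type) (_ : Group G), C G ∧ ∃ f : BS 1 n →* G, ∀ v w : ℤ,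
      ¬ IsConj (f (BSt 1 n ^ u * BSa 1 n ^ v)) (f (BSt 1 n ^ u' * BSa 1 n ^ w)) := by
  obtain ⟨p, hp⟩ := hC.primesOf_nonempty
  obtain ⟨N, hN⟩ : ∃ N, N = p ^ (u - u').natAbs := ⟨_, rfl⟩
  have hlt : (u - u').natAbs < N := hN ▸ Nat.lt_pow_self hp.1.one_lt
  have : NeZero N := ⟨by omega⟩
  obtain ⟨f, hfa, hft⟩ := BS_exists_hom (n := n) (G := Multiplicative (ZMod N)) (a := 1)
    (t := Multiplicative.ofAdd 1) (by simp)
  refine ⟨_, _, hC.of_isCyclic hper (Multiplicative (ZMod N)) ?_, f, fun v w hc => ?_⟩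
  · intro q hq hqd
    have hqN : q ∣ N := by simpa using hqd
    rw [hN] at hqN
    rwa [(Nat.prime_dvd_prime_iff_eq hq hp.1).1 (hq.dvd_of_dvd_pow hqN)]
  · rw [isConj_iff_eq] at hc
    simp only [map_mul, map_zpow, hfa, hft, one_zpow, mul_one, ← ofAdd_zsmul, zsmul_one,
      EmbeddingLike.apply_eq_iff_eq] at hc
    rw [← sub_eq_zero, ← Int.cast_sub, ZMod.intCast_zmod_eq_zero_iff_dvd,
      ← Int.natAbs_dvd_natAbs, Int.natAbs_natCast] at hc
    exact hlt.not_ge (Nat.le_of_dvd (by omega) hc)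

end IsRootClass

theorem isPInt_orderOf {C : GroupClass} {G : Type} [Group G] (hG : C G) (g : G) :
    IsPInt (PrimesOf C) (orderOf g) :=
  fun _ hp hpd => ⟨hp, G, _, hG, g, Int.natCast_dvd_natCast.1 hpd⟩

theorem orderOf_mem_OmegaP {C : GroupClass} (hper : PeriodicClass C) {G : Type} [Group G]
    (hG : C G) {n : ℤ} {a t : G} (h : a * t = t * a ^ n) :
    ((orderOf t : ℤ), (orderOf a : ℤ)) ∈ OmegaP n (PrimesOf C) := by
  refine ⟨Int.natCast_pos.2 (hper G hG t).orderOf_pos, Int.natCast_pos.2 (hper G hG a).orderOf_pos,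
    isPInt_orderOf hG t, isPInt_orderOf hG a, ?_⟩
  have := zpow_mul_pow_of_relation h 1 (orderOf t)
  rw [pow_orderOf_eq_one, mul_one, one_mul, one_mul] at this
  exact (zpow_eq_zpow_iff_modEq.1 this).symm

/-- `BS(1,n)` is conjugacy `𝒞`-separable iff non-conjugate elements `tᵘaᵛ`,
`tᵘaʷ` stay non-conjugate in some `H(n,r,s)` with `(r,s) ∈ Ω(n,𝔓(𝒞))` under the natural
projection. -/
theorem stmt12 (C : GroupClass) (hroot : IsRootClass C) (hper : PeriodicClass C)
    (n : ℤ) (hn : n ≠ 0) :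
    ConjSep C (BS 1 n) ↔
      ∀ u v w : ℤ,
        ¬ IsConj (BSt 1 n ^ u * BSa 1 n ^ v) (BSt 1 n ^ u * BSa 1 n ^ w) →
        ∃ r s : ℤ, (r, s) ∈ OmegaP n (PrimesOf C) ∧
          ∃ η : BS 1 n →* Hgrp n r s,
            η (BSa 1 n) = Ha n r s ∧ η (BSt 1 n) = Ht n r s ∧
            ¬ IsConj (η (BSt 1 n ^ u * BSa 1 n ^ v)) (η (BSt 1 n ^ u * BSa 1 n ^ w)) := by
  constructor
  · intro hsep u v w huvw
    obtain ⟨G, _, hG, σ, -, hσ⟩ := hsep _ _ huvw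
    have hrel : σ (BSa 1 n) * σ (BSt 1 n) = σ (BSt 1 n) * σ (BSa 1 n) ^ n := by
      simp only [← map_mul, ← map_zpow, BS_relation]
    obtain ⟨η, hηa, hηt⟩ := BS_exists_hom
      (Hgrp_relation n (orderOf (σ (BSt 1 n))) (orderOf (σ (BSa 1 n))))
    obtain ⟨f, hfa, hft⟩ := Hgrp_exists_hom hrel
      (r := orderOf (σ (BSt 1 n))) (s := orderOf (σ (BSa 1 n))) (by simp [pow_orderOf_eq_one])
      (by simp [pow_orderOf_eq_one])
    refine ⟨_, _, orderOf_mem_OmegaP hper hG hrel, η, hηa, hηt, fun hc => hσ ?_⟩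
    simpa [hηa, hηt, hfa, hft] using f.map_isConj hc
  · intro h x y hxy
    obtain ⟨u, v, hx⟩ := BS_exists_isConj x
    obtain ⟨u', w, hy⟩ := BS_exists_isConj y
    obtain ⟨G, _, hG, f, hf⟩ : ∃ (G : Type) (_ : Group G), C G ∧ ∃ f : BS 1 n →* G,
        ¬ IsConj (f (BSt 1 n ^ u * BSa 1 n ^ v)) (f (BSt 1 n ^ u' * BSa 1 n ^ w)) := by
      by_cases hu : u = u'
      · subst hu
        obtain ⟨r, s, hrs, η, -, -, hη⟩ := h u v w fun hc => hxy (hx.trans (hc.trans hy.symm))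
        exact ⟨_, _, hroot.Hgrp_mem hper hrs, η, hη⟩
      · obtain ⟨G, _, hG, f, hf⟩ := hroot.exists_hom_BS_of_ne hper n hu
        exact ⟨G, _, hG, f, hf v w⟩
    exact hroot.exists_surjective_of_hom hG f fun hc =>
      hf ((f.map_isConj hx).symm.trans (hc.trans (f.map_isConj hy)))
end

section
/- Let 𝒞 be a root class of groups consisting only of periodic groups. If BS(1,−1) is residually a 𝒞-group, then BS(1,−1) is conjugacy 𝓕𝓢_{𝔓(𝒞)}-separable. -/
/-- The homomorphism from `BS(1,-1)` determined by the images of its generators. -/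
def kleinLift {G : Type} [Group G] (a t : G) (hat : t⁻¹ * a * t = a⁻¹) : BS 1 (-1) →* G :=
  PresentedGroup.toGroup (rels := BSrels 1 (-1)) (f := fun b => cond b t a) (by
    rintro _ rfl
    simp [hat])

theorem kleinLift_a {G : Type} [Group G] (a t : G) (hat : t⁻¹ * a * t = a⁻¹) :
    kleinLift a t hat (BSa 1 (-1)) = a :=
  PresentedGroup.toGroup.of _

theorem kleinLift_t {G : Type} [Group G] (a t : G) (hat : t⁻¹ * a * t = a⁻¹) :
    kleinLift a t hat (BSt 1 (-1)) = t :=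
  PresentedGroup.toGroup.of _

theorem BS_one_neg_one_relation :
    (BSt 1 (-1))⁻¹ * BSa 1 (-1) * BSt 1 (-1) = (BSa 1 (-1))⁻¹ := by
  have h := PresentedGroup.one_of_mem (rels := BSrels 1 (-1)) (Set.mem_singleton _)
  simp only [map_mul, map_inv, zpow_one, neg_neg] at h
  exact eq_inv_of_mul_eq_one_left h

/-- Conjugation by a power of `t` inverts `a` according to the parity of the exponent. -/
theorem conj_zpow_of_inverts {G : Type} [Group G] {a t : G} (hat : t⁻¹ * a * t = a⁻¹) (k : ℤ) :
    (Even k → Commute a (t ^ k)) ∧ (Odd k → SemiconjBy (t ^ k) a a⁻¹) := by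
  have hs : SemiconjBy t a a⁻¹ := by
    have h2 : t⁻¹ * a⁻¹ * t = a := by simpa [mul_assoc] using congrArg (·⁻¹) hat
    change t * a = a⁻¹ * t
    nth_rw 1 [← h2]
    group
  have hs' : SemiconjBy t a⁻¹ a := by simpa using hs.inv_right
  have hsq : Commute a (t ^ (2 : ℤ)) := by
    have h : SemiconjBy (t * t) a a := hs'.mul_left hs
    rw [zpow_two]
    exact h.symm
  constructor
  · rintro ⟨m, rfl⟩
    rw [← two_mul, zpow_mul]
    exact hsq.zpow_right m
  · rintro ⟨m, rfl⟩
    rw [zpow_add, zpow_one, zpow_mul]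
    exact SemiconjBy.mul_left (hsq.zpow_right m).symm.inv_right hs

theorem BS_one_neg_one_normal_form (x : BS 1 (-1)) :
    ∃ k l : ℤ, x = BSt 1 (-1) ^ k * BSa 1 (-1) ^ l := by
  have hx : x ∈ Subgroup.closure (Set.range (PresentedGroup.of (rels := BSrels 1 (-1)))) := by
    rw [PresentedGroup.closure_range_of]
    trivial
  have move (k l e : ℤ) : ∃ k' l' : ℤ, BSa 1 (-1) ^ e * (BSt 1 (-1) ^ k * BSa 1 (-1) ^ l) =
      BSt 1 (-1) ^ k' * BSa 1 (-1) ^ l' := by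
    obtain ⟨he, ho⟩ := conj_zpow_of_inverts BS_one_neg_one_relation k
    rcases Int.even_or_odd k with hk | hk
    · exact ⟨k, e + l, by rw [← mul_assoc, ((he hk).zpow_left e).eq, mul_assoc, zpow_add]⟩
    · refine ⟨k, -e + l, ?_⟩
      have h := ((ho hk).zpow_right (-e)).eq
      rw [inv_zpow', neg_neg] at h
      rw [← mul_assoc, ← h, mul_assoc, zpow_add]
  induction hx using Subgroup.closure_induction_left with
  | one => exact ⟨0, 0, by simp; rfl⟩
  | mul_left x hx y _ ih =>
    obtain ⟨k, l, rfl⟩ := ih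
    obtain ⟨b, rfl⟩ := hx
    cases b
    · have h := move k l 1
      rwa [zpow_one] at h
    · exact ⟨1 + k, l, by rw [zpow_add, zpow_one, mul_assoc]; rfl⟩
  | inv_mul_cancel x hx y _ ih =>
    obtain ⟨k, l, rfl⟩ := ih
    obtain ⟨b, rfl⟩ := hx
    cases b
    · have h := move k l (-1)
      rwa [zpow_neg_one] at h
    · exact ⟨-1 + k, l, by rw [zpow_add, zpow_neg_one, mul_assoc]; rfl⟩

theorem two_mem_PrimesOf_of_residuallyIn {C : GroupClass} (h : ResiduallyIn C (BS 1 (-1))) :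
    2 ∈ PrimesOf C := by
  have hne : BSa 1 (-1) ≠ (BSa 1 (-1))⁻¹ := by
    intro he
    have hat : (DihedralGroup.sr 0 : DihedralGroup 3)⁻¹ * DihedralGroup.r 1 *
        DihedralGroup.sr 0 = (DihedralGroup.r 1)⁻¹ := by decide
    have h2 := congrArg (kleinLift _ _ hat) he
    rw [map_inv, kleinLift_a] at h2
    revert h2
    decide
  obtain ⟨G, _, hG, σ, -, hσ⟩ := h _ _ hne
  refine ⟨Nat.prime_two, G, ‹_›, hG, σ (BSt 1 (-1)), ?_⟩
  by_contra hodd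
  have hat : (σ (BSt 1 (-1)))⁻¹ * σ (BSa 1 (-1)) * σ (BSt 1 (-1)) = (σ (BSa 1 (-1)))⁻¹ := by
    simpa using congrArg σ BS_one_neg_one_relation
  have ho : Odd ((orderOf (σ (BSt 1 (-1))) : ℕ) : ℤ) := by
    rw [Int.odd_coe_nat, ← Nat.not_even_iff_odd, even_iff_two_dvd]
    exact hodd
  have hs := (conj_zpow_of_inverts hat _).2 ho
  rw [zpow_natCast, pow_orderOf_eq_one] at hs
  apply hσ
  simpa [SemiconjBy] using hs

/-- Nonconjugate images in a finite 2-group are separated by a finite solvable quotient. -/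
theorem exists_FSClass_quotient {P : Set ℕ} (hP : 2 ∈ P) {X G : Type} [Group X] [Group G] {n : ℕ}
    (hcard : Nat.card G = 2 ^ n) (σ : X →* G) {x y : X} (hxy : ¬IsConj (σ x) (σ y)) :
    ∃ (H : Type) (_ : Group H), FSClass P H ∧
      ∃ τ : X →* H, Function.Surjective τ ∧ ¬IsConj (τ x) (τ y) := by
  have : Finite G := Nat.finite_of_card_ne_zero (by rw [hcard]; positivity)
  have : Fact (Nat.Prime 2) := ⟨Nat.prime_two⟩
  have hp : IsPGroup 2 σ.range := (IsPGroup.of_card hcard).to_subgroup _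
  have := hp.isNilpotent
  refine ⟨σ.range, inferInstance,
    ⟨inferInstance, (inferInstance : Group.IsSolvable σ.range), fun p hp hdvd => ?_⟩,
    σ.rangeRestrict, σ.rangeRestrict_surjective, fun hc => hxy (σ.range.subtype.map_isConj hc)⟩
  have h2 : p ∣ 2 ^ n := hcard ▸ hdvd.trans (Subgroup.card_subgroup_dvd_card _)
  rwa [(Nat.prime_dvd_prime_iff_eq hp Nat.prime_two).1 (hp.dvd_of_dvd_pow h2)]

theorem DihedralGroup.eq_or_eq_neg_of_isConj_r {n : ℕ} {i j : ZMod n}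
    (h : IsConj (DihedralGroup.r i) (DihedralGroup.r j)) : i = j ∨ i = -j := by
  obtain ⟨c, hc⟩ := isConj_iff.1 h
  rcases c with c | c
  · left
    simpa using hc
  · right
    simp at hc
    rw [← hc, neg_neg]

theorem exists_two_pow_not_dvd {m : ℤ} (hm : m ≠ 0) : ∃ n : ℕ, ¬((2 ^ n : ℕ) : ℤ) ∣ m := by
  refine ⟨m.natAbs, fun h => ?_⟩
  have h1 := Nat.le_of_dvd (Int.natAbs_pos.2 hm) (Int.natCast_dvd.1 h)
  exact absurd h1 (not_le.2 Nat.lt_two_pow_self)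

/-- if `BS(1,-1)` is residually a `𝒞`-group, then it is conjugacy
`𝓕𝓢_{𝔓(𝒞)}`-separable. -/
theorem stmt13 (C : GroupClass) (hroot : IsRootClass C) (hper : PeriodicClass C)
    (h : ResiduallyIn C (BS 1 (-1))) :
    ConjSep (FSClass (PrimesOf C)) (BS 1 (-1)) := by
  have h2 := two_mem_PrimesOf_of_residuallyIn h
  intro x y hxy
  obtain ⟨k, l, rfl⟩ := BS_one_neg_one_normal_form x
  obtain ⟨k', l', rfl⟩ := BS_one_neg_one_normal_form y
  have hrel := BS_one_neg_one_relation
  by_cases hk : k = k'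
  · subst hk
    obtain ⟨he, ho⟩ := conj_zpow_of_inverts hrel k
    rcases Int.even_or_odd k with hk | hk
    · have hne : l - l' ≠ 0 := fun hl => hxy (by rw [sub_eq_zero.1 hl])
      have hne' : l + l' ≠ 0 := fun hl => hxy (by
        rw [isConj_iff]
        refine ⟨(BSt 1 (-1))⁻¹, ?_⟩
        have hal : (BSt 1 (-1))⁻¹ * BSa 1 (-1) ^ l * BSt 1 (-1) = BSa 1 (-1) ^ l' := by
          have := conj_zpow (i := l) (a := (BSt 1 (-1))⁻¹) (b := BSa 1 (-1))
          rw [inv_inv, hrel, inv_zpow', show -l = l' by omega] at this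
          exact this.symm
        rw [← hal]
        group)
      obtain ⟨n, hn⟩ := exists_two_pow_not_dvd (mul_ne_zero hne hne')
      have hat : (DihedralGroup.sr 0 : DihedralGroup (2 ^ n))⁻¹ * DihedralGroup.r 1 *
          DihedralGroup.sr 0 = (DihedralGroup.r 1)⁻¹ := by simp
      refine exists_FSClass_quotient h2 (n := n + 1) (by rw [DihedralGroup.nat_card, pow_succ'])
        (kleinLift _ _ hat) fun hc => hn ?_
      have ht : (DihedralGroup.sr 0 : DihedralGroup (2 ^ n)) ^ k = 1 := by
        obtain ⟨m, rfl⟩ := hk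
        rw [← two_mul, zpow_mul, zpow_two, DihedralGroup.sr_mul_self, one_zpow]
      simp only [map_mul, map_zpow, kleinLift_a, kleinLift_t, ht, one_mul,
        DihedralGroup.r_one_zpow] at hc
      rcases DihedralGroup.eq_or_eq_neg_of_isConj_r hc with hc | hc
      · refine Dvd.dvd.mul_right ((ZMod.intCast_zmod_eq_zero_iff_dvd _ _).1 ?_) _
        rw [Int.cast_sub, hc, sub_self]
      · refine Dvd.dvd.mul_left ((ZMod.intCast_zmod_eq_zero_iff_dvd _ _).1 ?_) _
        rw [Int.cast_add, hc, neg_add_cancel]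
    · have hodd : ¬((2 ^ 1 : ℕ) : ℤ) ∣ l - l' := by
        rintro ⟨m, hm⟩
        refine hxy (isConj_iff.2 ⟨BSa 1 (-1) ^ m, ?_⟩)
        have hs := ((ho hk).zpow_right (-m)).eq
        rw [inv_zpow', neg_neg] at hs
        rw [← mul_assoc, ← hs, mul_assoc, mul_assoc, ← zpow_neg, ← zpow_add, ← zpow_add]
        congr 2
        push_cast at hm
        omega
      refine exists_FSClass_quotient h2 (n := 1)
        (G := Multiplicative (ZMod (2 ^ 1))) (by simp)
        (kleinLift (Multiplicative.ofAdd 1) 1 (by decide)) fun hc => hodd ?_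
      rw [isConj_iff_eq] at hc
      simp only [map_mul, map_zpow, kleinLift_a, kleinLift_t, one_zpow, one_mul, ← ofAdd_zsmul,
        zsmul_one, EmbeddingLike.apply_eq_iff_eq] at hc
      rw [← ZMod.intCast_zmod_eq_zero_iff_dvd, Int.cast_sub, hc, sub_self]
  · obtain ⟨n, hn⟩ := exists_two_pow_not_dvd (sub_ne_zero.2 hk)
    refine exists_FSClass_quotient h2 (n := n)
      (G := Multiplicative (ZMod (2 ^ n))) (by simp)
      (kleinLift 1 (Multiplicative.ofAdd 1) (by simp)) fun hc => hn ?_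
    rw [isConj_iff_eq] at hc
    simp only [map_mul, map_zpow, kleinLift_a, kleinLift_t, one_zpow, mul_one, ← ofAdd_zsmul,
      zsmul_one, EmbeddingLike.apply_eq_iff_eq] at hc
    rw [← ZMod.intCast_zmod_eq_zero_iff_dvd, Int.cast_sub, hc, sub_self]
end
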